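/- arXiv:2408.02145 — 2 statements merged into one kernel-verified Lean document; each statement's English description precedes it below -/
import Mathlib

section
/- For every L ≥ 0, every s_0 ∈ [0,T), x_0 ∈ Ω, y_0 ∈ ℝ, and z ∈ ℝ^d, the set Y^L(s_0,x_0,y_0,z) is non-empty and is compact in Ω×C([s_0,T],ℝ) with respect to the supremum norm. -/
open MeasureTheory Set Filter Topology
open scoped InnerProductSpace

noncomputable section

namespace PHJ

/-- The Euclidean state space `ℝ^d`. -/
abbrev E (d : ℕ) := EuclideanSpace ℝ (Fin d)

/-- A path; only its values on `[0, T]` are relevant. -/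
abbrev Path (d : ℕ) := ℝ → E d

/-- The set `Ω = D([0,T], ℝ^d)` of paths that are right-continuous on `[0,T)` and have
left limits on `(0,T]`. -/
def Cadlag (T : ℝ) (d : ℕ) : Set (Path d) :=
  {x | (∀ t ∈ Ico (0 : ℝ) T, ContinuousWithinAt x (Ici t) t) ∧
       (∀ t ∈ Ioc (0 : ℝ) T, ∃ l : E d, Tendsto x (nhdsWithin t (Iio t)) (nhds l))}

/-- The running supremum `sup_{0 ≤ s ≤ t} |x(s)|`. -/
def runSup (d : ℕ) (x : Path d) (t : ℝ) : ℝ :=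
  sSup ((fun s => ‖x s‖) '' Icc 0 t)

/-- The supremum distance `sup_{0 ≤ s ≤ T} |x(s) − y(s)|`. -/
def supDist (T : ℝ) (d : ℕ) (x y : Path d) : ℝ :=
  sSup ((fun s => ‖x s - y s‖) '' Icc 0 T)

/-- The stopped supremum distance `sup_{0 ≤ r ≤ T} |x(r ∧ t) − y(r ∧ s)|`. -/
def stopDist (T : ℝ) (d : ℕ) (t : ℝ) (x : Path d) (s : ℝ) (y : Path d) : ℝ :=
  sSup ((fun r => ‖x (min r t) - y (min r s)‖) '' Icc 0 T)

/-- The pseudometric `d_∞` on `[0,T] × Ω`. -/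
def dInf (T : ℝ) (d : ℕ) (p q : ℝ × Path d) : ℝ :=
  |p.1 - q.1| + stopDist T d p.1 p.2 q.1 q.2

/-- `g` is an integrable a.e.-derivative of `x` on `[s₀, T]` (so that `x` is absolutely
continuous there) satisfying the growth bound `|x′(t)| ≤ L (1 + sup_{s ≤ t} |x(s)|)` a.e. -/
def XDeriv (T : ℝ) (d : ℕ) (L s₀ : ℝ) (x g : Path d) : Prop :=
  IntegrableOn g (Icc s₀ T) volume ∧
  (∀ t ∈ Icc s₀ T, x t = x s₀ + ∫ s in s₀..t, g s) ∧
  (∀ᵐ t ∂(volume.restrict (Ioo s₀ T)), ‖g t‖ ≤ L * (1 + runSup d x t))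

/-- The set `X^L(s₀, x₀)` of "Lipschitz-like" paths. -/
def XSet (T : ℝ) (d : ℕ) (L s₀ : ℝ) (x₀ : Path d) : Set (Path d) :=
  {x | x ∈ Cadlag T d ∧ (∀ t ∈ Icc 0 s₀, x t = x₀ t) ∧ ∃ g, XDeriv T d L s₀ x g}

/-- Type of Hamiltonians `H(t, x, y, z)`. -/
abbrev Ham (d : ℕ) := ℝ → Path d → ℝ → E d → ℝ

/-- The set `Y^L(s₀, x₀, y₀, z)` of characteristic pairs `(x, y)`. -/
def YSet (T : ℝ) (d : ℕ) (H : Ham d) (L s₀ : ℝ) (x₀ : Path d) (y₀ : ℝ) (z : E d) :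
    Set (Path d × (ℝ → ℝ)) :=
  {p | p.1 ∈ Cadlag T d ∧ (∀ t ∈ Icc 0 s₀, p.1 t = x₀ t) ∧
       ContinuousOn p.2 (Icc s₀ T) ∧
       ∃ g, XDeriv T d L s₀ p.1 g ∧
         IntegrableOn (fun s => ⟪g s, z⟫_ℝ - H s p.1 (p.2 s) z) (Icc s₀ T) volume ∧
         ∀ t ∈ Icc s₀ T, p.2 t = y₀ + ∫ s in s₀..t, (⟪g s, z⟫_ℝ - H s p.1 (p.2 s) z)}

/-- Assumption (i): for a.e. `t`, `(x, y, z) ↦ H(t, x, y, z)` is continuous. -/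
def HamCont (T : ℝ) (d : ℕ) (H : Ham d) : Prop :=
  ∀ᵐ t ∂(volume.restrict (Ioo (0 : ℝ) T)),
    ∀ x ∈ Cadlag T d, ∀ (y : ℝ) (z : E d), ∀ ε > (0 : ℝ), ∃ δ > (0 : ℝ),
      ∀ x' ∈ Cadlag T d, ∀ (y' : ℝ) (z' : E d),
        supDist T d x x' < δ → |y - y'| < δ → ‖z - z'‖ < δ →
        |H t x y z - H t x' y' z'| < ε

/-- Assumption (ii): `t ↦ H(t, x, y, z)` is Borel measurable. -/
def HamMeas (d : ℕ) (H : Ham d) : Prop :=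
  ∀ (x : Path d) (y : ℝ) (z : E d), Measurable fun t => H t x y z

/-- Assumption (iii): Lipschitz continuity in `z` with constant `L_H (1 + sup_{s≤t} |x(s)|)`. -/
def HamLipZ (T : ℝ) (d : ℕ) (H : Ham d) (LH : ℝ) : Prop :=
  0 ≤ LH ∧ ∀ᵐ t ∂(volume.restrict (Ioo (0 : ℝ) T)),
    ∀ x ∈ Cadlag T d, ∀ (y : ℝ) (z z' : E d),
      |H t x y z - H t x y z'| ≤ LH * (1 + runSup d x t) * ‖z - z'‖

/-- Assumption (iv): local Lipschitz continuity in `x` along `X^L`-paths,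
with constant `M L`. -/
def HamLipX (T : ℝ) (d : ℕ) (H : Ham d) (M : ℝ → ℝ) : Prop :=
  ∀ L ≥ (0 : ℝ), 0 ≤ M L ∧
    ∀ t₀ ∈ Ico (0 : ℝ) T, ∀ x₀ ∈ Cadlag T d,
      ∀ x ∈ XSet T d L t₀ x₀, ∀ x' ∈ XSet T d L t₀ x₀, ∀ (y : ℝ) (z : E d),
        ∀ᵐ t ∂(volume.restrict (Ioo t₀ T)),
          |H t x y z - H t x' y z| ≤
            M L * (1 + |y| + ‖z‖) * sSup ((fun s => ‖x s - x' s‖) '' Icc 0 t)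

/-- Assumption (v): `y ↦ H(t, x, y, z)` is non-increasing. -/
def HamMono (T : ℝ) (d : ℕ) (H : Ham d) : Prop :=
  ∀ᵐ t ∂(volume.restrict (Ioo (0 : ℝ) T)),
    ∀ x ∈ Cadlag T d, ∀ (z : E d) (y y' : ℝ), y ≤ y' → H t x y' z ≤ H t x y z

/-- Assumption (vi): growth bound `|H(t, x, y, 0)| ≤ C_H (1 + sup_{s≤t}|x(s)| + |y|)`. -/
def HamBound (T : ℝ) (d : ℕ) (H : Ham d) (CH : ℝ) : Prop :=
  0 ≤ CH ∧ ∀ᵐ t ∂(volume.restrict (Ioo (0 : ℝ) T)),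
    ∀ x ∈ Cadlag T d, ∀ y : ℝ, |H t x y 0| ≤ CH * (1 + runSup d x t + |y|)

/-- Lower semicontinuity on `[0,T] × Ω` with respect to `d_∞`. -/
def LscOn (T : ℝ) (d : ℕ) (u : ℝ → Path d → ℝ) : Prop :=
  ∀ t₀ ∈ Icc (0 : ℝ) T, ∀ x₀ ∈ Cadlag T d, ∀ c : ℝ, c < u t₀ x₀ →
    ∃ δ > (0 : ℝ), ∀ t ∈ Icc (0 : ℝ) T, ∀ x ∈ Cadlag T d,
      dInf T d (t₀, x₀) (t, x) < δ → c < u t x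

/-- Upper semicontinuity on `[0,T] × Ω` with respect to `d_∞`. -/
def UscOn (T : ℝ) (d : ℕ) (u : ℝ → Path d → ℝ) : Prop :=
  ∀ t₀ ∈ Icc (0 : ℝ) T, ∀ x₀ ∈ Cadlag T d, ∀ c : ℝ, u t₀ x₀ < c →
    ∃ δ > (0 : ℝ), ∀ t ∈ Icc (0 : ℝ) T, ∀ x ∈ Cadlag T d,
      dInf T d (t₀, x₀) (t, x) < δ → u t x < c

/-- Continuity of the terminal condition `h` with respect to the sup norm. -/
def TermCont (T : ℝ) (d : ℕ) (h : Path d → ℝ) : Prop :=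
  ∀ x ∈ Cadlag T d, ∀ ε > (0 : ℝ), ∃ δ > (0 : ℝ), ∀ x' ∈ Cadlag T d,
    supDist T d x x' < δ → |h x' - h x| < ε

/-- `u` is a minimax `L`-supersolution of the terminal-value problem (TVP). -/
def MinimaxSuper (T : ℝ) (d : ℕ) (H : Ham d) (h : Path d → ℝ) (L : ℝ)
    (u : ℝ → Path d → ℝ) : Prop :=
  LscOn T d u ∧ (∀ x ∈ Cadlag T d, h x ≤ u T x) ∧
  ∀ s₀ ∈ Ico (0 : ℝ) T, ∀ x₀ ∈ Cadlag T d, ∀ (z : E d) (y₀ : ℝ), u s₀ x₀ ≤ y₀ →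
    ∃ p ∈ YSet T d H L s₀ x₀ y₀ z, ∀ t ∈ Icc s₀ T, u t p.1 ≤ p.2 t

/-- `u` is a minimax `L`-subsolution of the terminal-value problem (TVP). -/
def MinimaxSub (T : ℝ) (d : ℕ) (H : Ham d) (h : Path d → ℝ) (L : ℝ)
    (u : ℝ → Path d → ℝ) : Prop :=
  UscOn T d u ∧ (∀ x ∈ Cadlag T d, u T x ≤ h x) ∧
  ∀ s₀ ∈ Ico (0 : ℝ) T, ∀ x₀ ∈ Cadlag T d, ∀ (z : E d) (y₀ : ℝ), y₀ ≤ u s₀ x₀ →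
    ∃ p ∈ YSet T d H L s₀ x₀ y₀ z, ∀ t ∈ Icc s₀ T, p.2 t ≤ u t p.1

/-- `u` is a minimax `L`-solution of the terminal-value problem (TVP). -/
def MinimaxSol (T : ℝ) (d : ℕ) (H : Ham d) (h : Path d → ℝ) (L : ℝ)
    (u : ℝ → Path d → ℝ) : Prop :=
  MinimaxSuper T d H h L u ∧ MinimaxSub T d H h L u

/-- Embedding of a path into the space of functions on `[0,T]` with the topology of
uniform convergence (i.e. the sup-norm topology). -/
def toUnif (T : ℝ) (d : ℕ) (x : Path d) : UniformFun (Icc (0 : ℝ) T) (E d) :=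
  UniformFun.ofFun fun s => x s.1

/-- Embedding of a real-valued function into the space of functions on `[s₀,T]` with the
topology of uniform convergence. -/
def toUnifR (T s₀ : ℝ) (y : ℝ → ℝ) : UniformFun (Icc s₀ T) ℝ :=
  UniformFun.ofFun fun s => y s.1

/-- Continuity on `[0,T] × Ω` with respect to `d_∞`. -/
def Cont2 (T : ℝ) (d : ℕ) (u : ℝ → Path d → ℝ) : Prop :=
  ∀ t₀ ∈ Icc (0 : ℝ) T, ∀ x₀ ∈ Cadlag T d, ∀ ε > (0 : ℝ), ∃ δ > (0 : ℝ),
    ∀ t ∈ Icc (0 : ℝ) T, ∀ x ∈ Cadlag T d,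
      dInf T d (t₀, x₀) (t, x) < δ → |u t x - u t₀ x₀| < ε

section RunningSup

variable {F : Type*} [NormedAddCommGroup F]

/-- The supremum of `‖u s‖` over `s ∈ [a, t]`. -/
def supOn (a : ℝ) (u : ℝ → F) (t : ℝ) : ℝ :=
  sSup ((fun s => ‖u s‖) '' Icc a t)

lemma supOn_nonneg (a : ℝ) (u : ℝ → F) (t : ℝ) : 0 ≤ supOn a u t := by
  apply Real.sSup_nonneg
  rintro _ ⟨s, _, rfl⟩
  exact norm_nonneg _

lemma norm_le_supOn {a T : ℝ} {u : ℝ → F} (hb : BddAbove ((fun s => ‖u s‖) '' Icc a T))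
    {s t : ℝ} (has : a ≤ s) (hst : s ≤ t) (htT : t ≤ T) : ‖u s‖ ≤ supOn a u t :=
  le_csSup (hb.mono (image_mono (Icc_subset_Icc_right htT))) ⟨s, ⟨has, hst⟩, rfl⟩

lemma supOn_le {a t M : ℝ} {u : ℝ → F} (hM : 0 ≤ M) (h : ∀ s ∈ Icc a t, ‖u s‖ ≤ M) :
    supOn a u t ≤ M := by
  apply Real.sSup_le _ hM
  rintro _ ⟨s, hs, rfl⟩
  exact h s hs

lemma supOn_mono {a T : ℝ} {u : ℝ → F} (hb : BddAbove ((fun s => ‖u s‖) '' Icc a T))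
    {s t : ℝ} (hst : s ≤ t) (htT : t ≤ T) : supOn a u s ≤ supOn a u t :=
  supOn_le (supOn_nonneg _ _ _) fun _ hr => norm_le_supOn hb hr.1 (hr.2.trans hst) htT

lemma supOn_congr {a t : ℝ} {u v : ℝ → F} (h : ∀ s ∈ Icc a t, u s = v s) :
    supOn a u t = supOn a v t := by
  unfold supOn
  congr 1
  exact image_congr fun s hs => by rw [h s hs]

/-- A discrete Grönwall inequality: a function whose increments on `[s₀, T]` are controlled by its
running supremum is bounded by a constant depending on its values up to `s₀` only. -/
lemma one_add_supOn_le {a s₀ T K : ℝ} (hT : s₀ ≤ T) (hK : 0 ≤ K) {u : ℝ → F}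
    (ha : a ≤ s₀) (hb : BddAbove ((fun s => ‖u s‖) '' Icc a T))
    (hu : ∀ s t, s₀ ≤ s → s ≤ t → t ≤ T → ‖u t - u s‖ ≤ K * (1 + supOn a u t) * (t - s)) :
    1 + supOn a u T ≤ 2 ^ ⌈2 * K * (T - s₀)⌉₊ * (1 + supOn a u s₀) := by
  have step : ∀ s t, s₀ ≤ s → s ≤ t → t ≤ T → 2 * K * (t - s) ≤ 1 →
      1 + supOn a u t ≤ 2 * (1 + supOn a u s) := by
    intro s t hs hst ht hK1
    have h0 := supOn_nonneg a u t
    have h1 := supOn_nonneg a u s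
    have : supOn a u t ≤ supOn a u s + K * (1 + supOn a u t) * (t - s) := by
      refine supOn_le (by have := sub_nonneg.2 hst; positivity) fun r hr => ?_
      rcases le_total r s with hrs | hrs
      · have := norm_le_supOn hb hr.1 hrs (hst.trans ht)
        have h2 : 0 ≤ K * (1 + supOn a u t) * (t - s) := by
          have := sub_nonneg.2 hst; positivity
        linarith
      · have h2 := hu s r hs hrs (hr.2.trans ht)
        have h3 := norm_le_supOn hb (ha.trans hs) le_rfl (hst.trans ht)
        have h4 : ‖u r‖ ≤ ‖u s‖ + ‖u r - u s‖ := by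
          simpa using norm_add_le (u s) (u r - u s)
        have h5 : K * (1 + supOn a u r) * (r - s) ≤ K * (1 + supOn a u t) * (t - s) := by
          have h6 := supOn_mono hb hr.2 ht
          have h7 := sub_nonneg.2 hrs
          have h8 := hr.2
          gcongr
        linarith
    nlinarith
  have main : ∀ k : ℕ, ∀ t, s₀ ≤ t → t ≤ T → 2 * K * (t - s₀) ≤ k →
      1 + supOn a u t ≤ 2 ^ k * (1 + supOn a u s₀) := by
    intro k
    induction k with
    | zero =>
      intro t h1 h2 h3
      have h3 : 2 * K * (t - s₀) ≤ 0 := by simpa using h3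
      have h4 : K * (t - s₀) = 0 := by
        have : 0 ≤ K * (t - s₀) := mul_nonneg hK (sub_nonneg.2 h1)
        linarith
      have : supOn a u t ≤ supOn a u s₀ := by
        refine supOn_le (supOn_nonneg _ _ _) fun r hr => ?_
        rcases le_total r s₀ with hrs | hrs
        · exact norm_le_supOn hb hr.1 hrs hT
        · have h5 := hu s₀ r le_rfl hrs (hr.2.trans h2)
          have h6 : K * (r - s₀) = 0 := by
            have h7 : 0 ≤ K * (r - s₀) := mul_nonneg hK (sub_nonneg.2 hrs)
            have h8 : K * (r - s₀) ≤ K * (t - s₀) := by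
              have := hr.2
              gcongr
            linarith
          have h7 : ‖u r - u s₀‖ ≤ 0 := by
            calc _ ≤ _ := h5
              _ = K * (r - s₀) * (1 + supOn a u r) := by ring
              _ = 0 := by rw [h6, zero_mul]
          have h8 : u r = u s₀ := sub_eq_zero.1 (norm_le_zero_iff.1 h7)
          rw [h8]
          exact norm_le_supOn hb ha le_rfl hT
      simpa using this
    | succ k ih =>
      intro t h1 h2 h3
      have hk : (0 : ℝ) < k + 1 := by positivity
      push_cast at h3
      have hd : 0 ≤ t - s₀ := sub_nonneg.2 h1
      set s := s₀ + (t - s₀) * (k / (k + 1)) with hs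
      have hq : (k : ℝ) / (k + 1) ≤ 1 := by rw [div_le_one hk]; linarith
      have hq0 : (0 : ℝ) ≤ k / (k + 1) := by positivity
      have hs1 : s₀ ≤ s := by rw [hs]; have := mul_nonneg hd hq0; linarith
      have hs2 : s ≤ t := by rw [hs]; nlinarith
      have e1 : t - s = (t - s₀) / (k + 1) := by rw [hs]; field_simp; ring
      have h4 := step s t hs1 hs2 h2 (by
        rw [e1, ← mul_div_assoc, div_le_one hk]; exact h3)
      have h5 := ih s hs1 (hs2.trans h2) (by
        have : 2 * K * (s - s₀) = 2 * K * (t - s₀) / (k + 1) * k := by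
          rw [hs]; field_simp; ring
        rw [this]
        have : 2 * K * (t - s₀) / (k + 1) ≤ 1 := by rw [div_le_one hk]; exact h3
        have hk0 : (0 : ℝ) ≤ k := by positivity
        nlinarith)
      rw [pow_succ]
      linarith
  exact main _ T hT le_rfl (Nat.le_ceil _)

/-- Increments of an indefinite integral whose integrand is controlled by the running supremum. -/
lemma norm_sub_le_of_ae_le [NormedSpace ℝ F] {a s₀ T K : ℝ} (hK : 0 ≤ K) {u w : ℝ → F}
    (hb : BddAbove ((fun s => ‖u s‖) '' Icc a T)) (hw : IntegrableOn w (Icc s₀ T) volume)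
    (hu : ∀ t ∈ Icc s₀ T, u t = u s₀ + ∫ s in s₀..t, w s)
    (hwb : ∀ᵐ t ∂(volume.restrict (Ioo s₀ T)), ‖w t‖ ≤ K * (1 + supOn a u t))
    (s t : ℝ) (hs : s₀ ≤ s) (hst : s ≤ t) (ht : t ≤ T) :
    ‖u t - u s‖ ≤ K * (1 + supOn a u t) * (t - s) := by
  have hint : ∀ r ∈ Icc s₀ T, IntervalIntegrable w volume s₀ r := fun r hr =>
    (intervalIntegrable_iff_integrableOn_Icc_of_le hr.1).2
      (hw.mono_set (Icc_subset_Icc_right hr.2))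
  have hs' : s ∈ Icc s₀ T := ⟨hs, hst.trans ht⟩
  have ht' : t ∈ Icc s₀ T := ⟨hs.trans hst, ht⟩
  have e : u t - u s = ∫ r in s..t, w r := by
    rw [hu t ht', hu s hs', add_sub_add_left_eq_sub,
      intervalIntegral.integral_interval_sub_left (hint t ht') (hint s hs')]
  rw [e, ← abs_of_nonneg (sub_nonneg.2 hst)]
  apply intervalIntegral.norm_integral_le_of_norm_le_const_ae
  rw [ae_restrict_iff' measurableSet_Ioo] at hwb
  have hne : ∀ᵐ r : ℝ, r ≠ T := by simp [ae_iff, measure_singleton]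
  filter_upwards [hwb, hne] with r hr hrT hrm
  rw [uIoc_of_le hst] at hrm
  refine (hr ⟨hs.trans_lt hrm.1, lt_of_le_of_ne (hrm.2.trans ht) hrT⟩).trans ?_
  have := supOn_mono hb hrm.2 ht
  gcongr

end RunningSup

section CadlagPaths

variable {T : ℝ} {d : ℕ}

lemma Cadlag.bddAbove {x : Path d} (hx : x ∈ Cadlag T d) {t : ℝ} (ht : t ≤ T) :
    BddAbove ((fun s => ‖x s‖) '' Icc 0 t) := by
  suffices h : BddAbove ((fun s => ‖x s‖) '' Icc 0 T) from
    h.mono (image_mono (Icc_subset_Icc_right ht))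
  have hloc : ∀ (f : Filter ℝ) (l : E d), Tendsto x f (𝓝 l) →
      ∃ s ∈ f, BddAbove ((fun s => ‖x s‖) '' s) := by
    intro f l hl
    refine ⟨{s | ‖x s‖ < ‖l‖ + 1}, hl.norm.eventually_lt_const (by linarith), ‖l‖ + 1, ?_⟩
    rintro _ ⟨s, hs, rfl⟩
    exact le_of_lt hs
  refine isCompact_Icc.induction_on (p := fun s => BddAbove ((fun s => ‖x s‖) '' s)) (by simp)
    (fun s t hst ht => ht.mono (image_mono hst))
    (fun s t hs ht => by rw [image_union]; exact hs.union ht) fun t ht => ?_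
  have hleft : ∃ s ∈ 𝓝[Icc 0 T ∩ Iio t] t, BddAbove ((fun s => ‖x s‖) '' s) := by
    rcases ht.1.eq_or_lt with rfl | h0
    · refine ⟨∅, ?_, by simp⟩
      have : Icc (0 : ℝ) T ∩ Iio 0 = ∅ := by
        ext r; simp only [mem_inter_iff, mem_Icc, mem_Iio, mem_empty_iff_false]; grind
      rw [this, nhdsWithin_empty]
      exact mem_bot
    · obtain ⟨l, hl⟩ := hx.2 t ⟨h0, ht.2⟩
      exact hloc _ l (hl.mono_left (nhdsWithin_mono _ inter_subset_right))
  have hright : ∃ s ∈ 𝓝[Icc 0 T ∩ Ici t] t, BddAbove ((fun s => ‖x s‖) '' s) := by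
    rcases ht.2.eq_or_lt with rfl | hT
    · refine ⟨{t}, ?_, by simp⟩
      have : Icc (0 : ℝ) t ∩ Ici t ⊆ {t} := by
        intro r; simp only [mem_inter_iff, mem_Icc, mem_Ici, mem_singleton_iff]; grind
      exact mem_of_superset self_mem_nhdsWithin this
    · exact hloc _ _ ((hx.1 t ⟨ht.1, hT⟩).mono_left (nhdsWithin_mono _ inter_subset_right))
  obtain ⟨s₁, hs₁, hb₁⟩ := hleft
  obtain ⟨s₂, hs₂, hb₂⟩ := hright
  refine ⟨s₁ ∪ s₂, ?_, by rw [image_union]; exact hb₁.union hb₂⟩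
  have : Icc 0 T = (Icc 0 T ∩ Iio t) ∪ (Icc 0 T ∩ Ici t) := by
    rw [← inter_union_distrib_left, Iio_union_Ici, inter_univ]
  rw [this, nhdsWithin_union]
  exact union_mem_sup hs₁ hs₂

/-- Replacing a càdlàg path by a continuous continuation after time `s₀` gives a càdlàg path. -/
lemma Cadlag.of_continuousOn {s₀ : ℝ} {x₀ x : Path d} (hx₀ : x₀ ∈ Cadlag T d)
    (h₀ : ∀ t ∈ Icc 0 s₀, x t = x₀ t) (hc : ContinuousOn x (Icc s₀ T)) : x ∈ Cadlag T d := by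
  refine ⟨fun t ht => ?_, fun t ht => ?_⟩
  · rcases lt_or_ge t s₀ with h | h
    · refine (hx₀.1 t ht).congr_of_eventuallyEq ?_ (h₀ t ⟨ht.1, h.le⟩)
      filter_upwards [Ico_mem_nhdsGE h] with r hr
      exact h₀ r ⟨ht.1.trans hr.1, hr.2.le⟩
    · refine (hc t ⟨h, ht.2.le⟩).mono_of_mem_nhdsWithin ?_
      filter_upwards [Ico_mem_nhdsGE ht.2] with r hr
      exact ⟨h.trans hr.1, hr.2.le⟩
  · rcases le_or_gt t s₀ with h | h
    · obtain ⟨l, hl⟩ := hx₀.2 t ht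
      refine ⟨l, hl.congr' ?_⟩
      filter_upwards [Ioo_mem_nhdsLT ht.1] with r hr
      exact (h₀ r ⟨hr.1.le, hr.2.le.trans h⟩).symm
    · refine ⟨x t, (hc t ⟨h.le, ht.2⟩).mono_left (nhdsWithin_le_of_mem ?_)⟩
      filter_upwards [Ioo_mem_nhdsLT h] with r hr
      exact ⟨hr.1.le, hr.2.le.trans ht.2⟩

lemma supDist_self (x : Path d) : supDist T d x x = 0 := by
  refine le_antisymm (Real.sSup_le ?_ le_rfl) (Real.sSup_nonneg ?_)
  · rintro _ ⟨s, _, rfl⟩; simp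
  · rintro _ ⟨s, _, rfl⟩; exact norm_nonneg _

end CadlagPaths

section Hamiltonian

variable {T : ℝ} {d : ℕ} {H : Ham d}

lemma HamCont.tendsto (h : HamCont T d H) (z : E d) :
    ∀ᵐ t ∂(volume.restrict (Ioo (0 : ℝ) T)), ∀ x ∈ Cadlag T d, ∀ xs : ℕ → Path d,
      (∀ n, xs n ∈ Cadlag T d) → Tendsto (fun n => supDist T d x (xs n)) atTop (𝓝 0) →
      ∀ (y : ℝ) (ys : ℕ → ℝ), Tendsto ys atTop (𝓝 y) →
        Tendsto (fun n => H t (xs n) (ys n) z) atTop (𝓝 (H t x y z)) := by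
  filter_upwards [h] with t ht x hx xs hxs hlim y ys hys
  rw [Metric.tendsto_atTop']
  intro ε hε
  obtain ⟨δ, hδ, hH⟩ := ht x hx y z ε hε
  have h1 := hlim.eventually_lt_const hδ
  have h2 := Metric.tendsto_nhds.1 hys δ hδ
  obtain ⟨N, hN⟩ := eventually_atTop.1 (h1.and h2)
  refine ⟨N, fun n hn => ?_⟩
  have h3 := hN n hn.le
  rw [dist_comm, Real.dist_eq]
  refine hH _ (hxs n) _ z h3.1 ?_ (by simpa using hδ)
  have := h3.2
  rwa [dist_comm, Real.dist_eq] at this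

/-- Carathéodory functions preserve measurability. -/
lemma aestronglyMeasurable_ham (h1 : HamCont T d H) (h2 : HamMeas d H) {s₀ : ℝ} (hs₀ : 0 ≤ s₀)
    {x : Path d} (hx : x ∈ Cadlag T d) (z : E d) {η : ℝ → ℝ}
    (hη : AEStronglyMeasurable η (volume.restrict (Ioo s₀ T))) :
    AEStronglyMeasurable (fun s => H s x (η s) z) (volume.restrict (Ioo s₀ T)) := by
  obtain ⟨η', hη', he⟩ := hη
  have hlim := (h1.tendsto z).filter_mono
    (ae_mono (Measure.restrict_mono_set volume (Ioo_subset_Ioo_left hs₀)))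
  have hm : AEStronglyMeasurable (fun s => H s x (η' s) z) (volume.restrict (Ioo s₀ T)) := by
    refine aestronglyMeasurable_of_tendsto_ae atTop (f := fun n s => H s x (hη'.approx n s) z)
      (fun n => ((hη'.approx n).measurable_bind (fun b s => H s x b z)
        fun b => h2 x b z).aestronglyMeasurable) ?_
    filter_upwards [hlim] with s hs
    exact hs x hx (fun _ => x) (fun _ => hx) (by simp [supDist_self]) _ _ (hη'.tendsto_approx s)
  refine hm.congr ?_
  filter_upwards [he] with s hs
  rw [hs]

lemma ham_bound {LH CH : ℝ} (h3 : HamLipZ T d H LH) (h6 : HamBound T d H CH) (z : E d) {R : ℝ}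
    (hR : 0 ≤ R) :
    ∀ᵐ t ∂(volume.restrict (Ioo (0 : ℝ) T)), ∀ x ∈ Cadlag T d, runSup d x t ≤ R →
      ∀ y : ℝ, |H t x y z| ≤ (CH + LH * ‖z‖) * (1 + R) * (1 + |y|) := by
  filter_upwards [h3.2, h6.2] with t ht3 ht6 x hx hxR y
  have hLH := h3.1
  have hCH := h6.1
  have e1 := ht3 x hx y z 0
  have e2 := ht6 x hx y
  rw [sub_zero] at e1
  have e3 : |H t x y z| ≤ |H t x y z - H t x y 0| + |H t x y 0| := by
    simpa using abs_add_le (H t x y z - H t x y 0) (H t x y 0)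
  have e4 : LH * (1 + runSup d x t) * ‖z‖ ≤ LH * (1 + R) * ‖z‖ := by gcongr
  have e5 : CH * (1 + runSup d x t + |y|) ≤ CH * (1 + R + |y|) := by gcongr
  have hy := abs_nonneg y
  have e6 : 0 ≤ CH * (R * |y|) := by positivity
  have e7 : 0 ≤ LH * ‖z‖ * (1 + R) * |y| := by positivity
  nlinarith

end Hamiltonian

section Calculus

lemma exists_subseq_tendstoUniformlyOn {F : Type*} [NormedAddCommGroup F] [ProperSpace F]
    {a b K B : ℝ} {u : ℕ → ℝ → F}
    (hK : ∀ n s t, a ≤ s → s ≤ t → t ≤ b → ‖u n t - u n s‖ ≤ K * (t - s))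
    (hB : ∀ n, ∀ t ∈ Icc a b, ‖u n t‖ ≤ B) :
    ∃ φ : ℕ → ℕ, StrictMono φ ∧ ∃ v : ℝ → F,
      TendstoUniformlyOn (fun n => u (φ n)) v atTop (Icc a b) := by
  have hlip : ∀ n, LipschitzWith K.toNNReal (fun t : Icc a b => u n t) := by
    intro n
    refine LipschitzWith.of_dist_le_mul fun s t => ?_
    have hKK := Real.le_coe_toNNReal K
    rcases le_total s.1 t.1 with h | h
    · rw [dist_comm, dist_eq_norm, dist_comm s t, Subtype.dist_eq, Real.dist_eq,
        abs_of_nonneg (sub_nonneg.2 h)]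
      exact (hK n s t s.2.1 h t.2.2).trans
        (mul_le_mul_of_nonneg_right hKK (sub_nonneg.2 h))
    · rw [dist_eq_norm, Subtype.dist_eq, Real.dist_eq, abs_of_nonneg (sub_nonneg.2 h)]
      exact (hK n t s t.2.1 h s.2.2).trans
        (mul_le_mul_of_nonneg_right hKK (sub_nonneg.2 h))
  let f : ℕ → BoundedContinuousFunction (Icc a b) F := fun n =>
    BoundedContinuousFunction.mkOfCompact ⟨fun t => u n t, (hlip n).continuous⟩
  have hcomp := BoundedContinuousFunction.arzela_ascoli (Metric.closedBall (0 : F) B)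
    (isCompact_closedBall 0 B) (range f)
    (by rintro _ t ⟨n, rfl⟩; simpa [f] using hB n t t.2)
    (by
      refine (LipschitzWith.uniformEquicontinuous _ K.toNNReal ?_).equicontinuous
      rintro ⟨_, n, rfl⟩
      exact hlip n)
  obtain ⟨v, -, φ, hφ, hv⟩ := hcomp.isSeqCompact (fun n => subset_closure (mem_range_self n))
  refine ⟨φ, hφ, Function.extend Subtype.val v 0, ?_⟩
  rw [tendstoUniformlyOn_iff_tendstoUniformly_comp_coe]
  rw [BoundedContinuousFunction.tendsto_iff_tendstoUniformly] at hv
  have e : (Function.extend Subtype.val v 0 ∘ Subtype.val : Icc a b → F) = v := by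
    ext t
    exact Subtype.val_injective.extend_apply _ _ _
  rw [e]
  exact hv

/-- A path whose increments are controlled by its running supremum has an integrable derivative
satisfying the growth bound. -/
lemma exists_xDeriv {T s₀ L : ℝ} {d : ℕ} {x : Path d} (hT : s₀ ≤ T) (hL : 0 ≤ L)
    (hb : BddAbove ((fun s => ‖x s‖) '' Icc 0 T))
    (h : ∀ s t, s₀ ≤ s → s ≤ t → t ≤ T → ‖x t - x s‖ ≤ L * (1 + runSup d x t) * (t - s)) :
    ∃ g, XDeriv T d L s₀ x g := by
  set K : ℝ := L * (1 + runSup d x T) with hK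
  have hK0 : 0 ≤ K := mul_nonneg hL (add_nonneg zero_le_one (supOn_nonneg 0 x T))
  set y : Path d := fun t => x (projIcc s₀ T hT t) with hy
  have hyx : ∀ t ∈ Icc s₀ T, y t = x t := fun t ht => by rw [hy]; simp [projIcc_of_mem hT ht]
  have hmono : ∀ s t, s₀ ≤ s → s ≤ t → t ≤ T → ‖x t - x s‖ ≤ K * (t - s) := by
    intro s t hs hst ht
    refine (h s t hs hst ht).trans ?_
    have : runSup d x t ≤ runSup d x T := supOn_mono hb ht le_rfl
    have := sub_nonneg.2 hst
    rw [hK]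
    gcongr
  have hlip : LipschitzWith K.toNNReal y := by
    have h1 : LipschitzWith K.toNNReal (fun t : Icc s₀ T => x t) := by
      refine LipschitzWith.of_dist_le_mul fun s t => ?_
      rw [Real.coe_toNNReal _ hK0]
      rcases le_total s.1 t.1 with h | h
      · rw [dist_comm, dist_eq_norm, dist_comm s t, Subtype.dist_eq, Real.dist_eq,
          abs_of_nonneg (sub_nonneg.2 h)]
        exact hmono s t s.2.1 h t.2.2
      · rw [dist_eq_norm, Subtype.dist_eq, Real.dist_eq, abs_of_nonneg (sub_nonneg.2 h)]
        exact hmono t s t.2.1 h s.2.2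
    have h2 := h1.comp (LipschitzWith.projIcc hT)
    rw [mul_one] at h2
    exact h2
  have hdiff := hlip.ae_differentiableAt_real
  have hbd : ∀ t, ‖deriv y t‖ ≤ K := fun t => by
    simpa [Real.coe_toNNReal _ hK0] using norm_deriv_le_of_lipschitz (x₀ := t) hlip
  have hint : ∀ a b : ℝ, IntervalIntegrable (deriv y) volume a b := fun a b => by
    rw [intervalIntegrable_iff]
    exact Measure.integrableOn_of_bounded (M := K) (by simp [uIoc])
      (stronglyMeasurable_deriv y).aestronglyMeasurable (Eventually.of_forall hbd)
  refine ⟨deriv y, ?_, fun t ht => ?_, ?_⟩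
  · exact (intervalIntegrable_iff_integrableOn_Icc_of_le hT).1 (hint s₀ T)
  · rw [← hyx t ht, ← hyx s₀ ⟨le_rfl, hT⟩, ← sub_eq_iff_eq_add']
    ext i
    have hi : LipschitzWith (1 * K.toNNReal) (fun t => y t i) :=
      (LipschitzWith.of_dist_le_mul (f := fun v : E d => v i) fun v w => by
        rw [NNReal.coe_one, one_mul, dist_eq_norm, dist_eq_norm]
        exact PiLp.norm_apply_le (v - w) i).comp hlip
    have h1 := (hi.lipschitzOnWith
      (s := uIcc s₀ t)).absolutelyContinuousOnInterval.integral_deriv_eq_sub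
    have h2 : (∫ s in s₀..t, deriv y s) i = ∫ s in s₀..t, (deriv y s) i :=
      ((EuclideanSpace.proj (𝕜 := ℝ) i).intervalIntegral_comp_comm (hint s₀ t)).symm
    rw [h2, PiLp.sub_apply, ← h1]
    refine intervalIntegral.integral_congr_ae ?_
    filter_upwards [hdiff] with s hs _
    exact ((EuclideanSpace.proj (𝕜 := ℝ) i).hasFDerivAt.comp_hasDerivAt s hs.hasDerivAt).deriv
  · rw [ae_restrict_iff' measurableSet_Ioo]
    filter_upwards [hdiff] with t hd ht
    have hs := (hasDerivAt_iff_tendsto_slope.1 hd.hasDerivAt).mono_left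
      (nhdsWithin_mono t (s := Iio t) fun s hs => ne_of_lt hs)
    refine le_of_tendsto hs.norm ?_
    filter_upwards [Ioo_mem_nhdsLT ht.1] with s hs
    have h1 := h s t hs.1.le hs.2.le ht.2.le
    have h2 : 0 < t - s := sub_pos.2 hs.2
    rw [slope_def_module, norm_smul, hyx t ⟨ht.1.le, ht.2.le⟩,
      hyx s ⟨hs.1.le, hs.2.le.trans ht.2.le⟩, norm_inv, Real.norm_eq_abs, abs_sub_comm,
      abs_of_pos h2, norm_sub_rev, inv_mul_le_iff₀ h2]
    linarith

end Calculus

section Limits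

variable {T s₀ : ℝ} {d : ℕ} {H : Ham d} {LH CH : ℝ}

lemma integrableOn_ham (h1 : HamCont T d H) (h2 : HamMeas d H) (h3 : HamLipZ T d H LH)
    (h6 : HamBound T d H CH) (hs₀ : 0 ≤ s₀) {x : Path d} (hx : x ∈ Cadlag T d) (z : E d)
    {η : ℝ → ℝ} {B : ℝ} (hη : AEStronglyMeasurable η (volume.restrict (Ioo s₀ T)))
    (hB : ∀ s ∈ Ioo s₀ T, |η s| ≤ B) :
    IntegrableOn (fun s => H s x (η s) z) (Icc s₀ T) volume := by
  rw [integrableOn_Icc_iff_integrableOn_Ioo]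
  have hR : 0 ≤ runSup d x T := supOn_nonneg 0 x T
  have hbd := (ham_bound h3 h6 z hR).filter_mono
    (ae_mono (Measure.restrict_mono_set volume (Ioo_subset_Ioo_left hs₀)))
  refine Integrable.of_bound (aestronglyMeasurable_ham h1 h2 hs₀ hx z hη)
    ((CH + LH * ‖z‖) * (1 + runSup d x T) * (1 + B)) ?_
  filter_upwards [hbd, ae_restrict_mem measurableSet_Ioo] with s hs hsm
  refine (hs x hx (supOn_mono (Cadlag.bddAbove hx le_rfl) hsm.2.le le_rfl) (η s)).trans ?_
  have := hB s hsm
  have := h3.1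
  have := h6.1
  gcongr

lemma tendsto_integral_ham (h1 : HamCont T d H) (h2 : HamMeas d H) (h3 : HamLipZ T d H LH)
    (h6 : HamBound T d H CH) (hs₀ : 0 ≤ s₀) {x : Path d} {xs : ℕ → Path d}
    (hx : x ∈ Cadlag T d) (hxs : ∀ n, xs n ∈ Cadlag T d)
    (hlim : Tendsto (fun n => supDist T d x (xs n)) atTop (𝓝 0))
    {R : ℝ} (hR : ∀ n, runSup d (xs n) T ≤ R) (z : E d) {η : ℝ → ℝ} {ηs : ℕ → ℝ → ℝ} {B : ℝ}
    (hηm : ∀ n, AEStronglyMeasurable (ηs n) (volume.restrict (Ioo s₀ T)))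
    (hB : ∀ n, ∀ s ∈ Ioo s₀ T, |ηs n s| ≤ B)
    (hη : ∀ s ∈ Ioo s₀ T, Tendsto (fun n => ηs n s) atTop (𝓝 (η s)))
    {t : ℝ} (ht : t ∈ Icc s₀ T) :
    Tendsto (fun n => ∫ s in s₀..t, H s (xs n) (ηs n s) z) atTop
      (𝓝 (∫ s in s₀..t, H s x (η s) z)) := by
  have hR0 : 0 ≤ R := (supOn_nonneg 0 (xs 0) T).trans (hR 0)
  have hsub := ae_mono (Measure.restrict_mono_set volume (Ioo_subset_Ioo_left (b := T) hs₀))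
  have hbd := (ham_bound h3 h6 z hR0).filter_mono hsub
  have hten := (h1.tendsto z).filter_mono hsub
  rw [ae_restrict_iff' measurableSet_Ioo] at hbd hten
  have hne : ∀ᵐ r : ℝ, r ≠ T := by simp [ae_iff, measure_singleton]
  have hmem : ∀ r, r ≠ T → r ∈ uIoc s₀ t → r ∈ Ioo s₀ T := by
    intro r hr hrm
    rw [uIoc_of_le ht.1] at hrm
    exact ⟨hrm.1, lt_of_le_of_ne (hrm.2.trans ht.2) hr⟩
  refine intervalIntegral.tendsto_integral_filter_of_dominated_convergence
    (fun _ => (CH + LH * ‖z‖) * (1 + R) * (1 + B)) (Eventually.of_forall fun n => ?_)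
    (Eventually.of_forall fun n => ?_) intervalIntegrable_const ?_
  · have hm := aestronglyMeasurable_ham h1 h2 hs₀ (hxs n) z (hηm n)
    rw [Measure.restrict_congr_set Ioo_ae_eq_Ioc] at hm
    rw [uIoc_of_le ht.1]
    exact hm.mono_measure (Measure.restrict_mono_set volume (Ioc_subset_Ioc_right ht.2))
  · filter_upwards [hbd, hne] with r hr hrT hrm
    have hrm := hmem r hrT hrm
    refine (hr hrm (xs n) (hxs n) ((supOn_mono (Cadlag.bddAbove (hxs n) le_rfl) hrm.2.le
      le_rfl).trans (hR n)) (ηs n r)).trans ?_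
    have := hB n r hrm
    have := h3.1
    have := h6.1
    gcongr
  · filter_upwards [hten, hne] with r hr hrT hrm
    have hrm := hmem r hrT hrm
    exact hr hrm x hx xs hxs hlim _ _ (hη r hrm)

/-- Limits of approximate characteristic pairs, in which the second argument of the Hamiltonian may
be a perturbation `ηs n` of `ys n`, are characteristic pairs. -/
lemma mem_YSet_of_tendsto (h1 : HamCont T d H) (h2 : HamMeas d H) (h3 : HamLipZ T d H LH)
    (h6 : HamBound T d H CH) {L : ℝ} (hL : 0 ≤ L) (hs₀ : s₀ ∈ Ico 0 T) {x₀ : Path d}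
    (hx₀ : x₀ ∈ Cadlag T d) {y₀ : ℝ} {z : E d} {x : Path d} {xs : ℕ → Path d}
    {y : ℝ → ℝ} {ys ηs : ℕ → ℝ → ℝ} {R B : ℝ}
    (hxs : ∀ n, xs n ∈ Cadlag T d) (hxs₀ : ∀ n, ∀ t ∈ Icc 0 s₀, xs n t = x₀ t)
    (hx : ∀ t ∈ Icc 0 s₀, x t = x₀ t)
    (hxL : ∀ n s t, s₀ ≤ s → s ≤ t → t ≤ T →
      ‖xs n t - xs n s‖ ≤ L * (1 + runSup d (xs n) t) * (t - s))
    (hR : ∀ n, runSup d (xs n) T ≤ R)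
    (hlim : TendstoUniformlyOn xs x atTop (Icc s₀ T))
    (hy : ContinuousOn y (Icc s₀ T))
    (hηm : ∀ n, AEStronglyMeasurable (ηs n) (volume.restrict (Ioo s₀ T)))
    (hB : ∀ n, ∀ s ∈ Ioo s₀ T, |ηs n s| ≤ B)
    (hη : ∀ s ∈ Ioo s₀ T, Tendsto (fun n => ηs n s) atTop (𝓝 (y s)))
    (hys : ∀ t ∈ Icc s₀ T, Tendsto (fun n => ys n t) atTop (𝓝 (y t)))
    (hyint : ∀ n, ∀ t ∈ Icc s₀ T, ys n t = y₀ + ⟪xs n t - xs n s₀, z⟫_ℝ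
      - ∫ s in s₀..t, H s (xs n) (ηs n s) z) :
    (x, y) ∈ YSet T d H L s₀ x₀ y₀ z := by
  have hT := hs₀.2.le
  have hR0 : 0 ≤ R := (supOn_nonneg 0 (xs 0) T).trans (hR 0)
  have hcont : ∀ n, ContinuousOn (xs n) (Icc s₀ T) := by
    intro n
    have hK : ∀ s t, s₀ ≤ s → s ≤ t → t ≤ T →
        ‖xs n t - xs n s‖ ≤ L * (1 + R) * (t - s) := fun s t hs hst ht => by
      refine (hxL n s t hs hst ht).trans ?_
      have : runSup d (xs n) t ≤ R :=
        (supOn_mono (Cadlag.bddAbove (hxs n) le_rfl) ht le_rfl).trans (hR n)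
      have := sub_nonneg.2 hst
      gcongr
    refine (LipschitzOnWith.of_dist_le_mul (K := (L * (1 + R)).toNNReal)
      fun s hs t ht => ?_).continuousOn
    rw [Real.coe_toNNReal _ (by positivity)]
    rcases le_total s t with h | h
    · rw [dist_comm, dist_eq_norm, dist_comm s t, Real.dist_eq, abs_of_nonneg (sub_nonneg.2 h)]
      exact hK s t hs.1 h ht.2
    · rw [dist_eq_norm, Real.dist_eq, abs_of_nonneg (sub_nonneg.2 h)]
      exact hK t s ht.1 h hs.2
  have hxc : ContinuousOn x (Icc s₀ T) :=
    hlim.continuousOn (Eventually.of_forall hcont).frequently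
  have hxC : x ∈ Cadlag T d := Cadlag.of_continuousOn hx₀ hx hxc
  have hbx := Cadlag.bddAbove hxC le_rfl
  have hclose : ∀ ε > 0, ∀ᶠ n in atTop, ∀ s ∈ Icc 0 T, ‖x s - xs n s‖ ≤ ε := by
    intro ε hε
    filter_upwards [Metric.tendstoUniformlyOn_iff.1 hlim ε hε] with n hn s hs
    rcases le_total s s₀ with h | h
    · rw [hx s ⟨hs.1, h⟩, hxs₀ n s ⟨hs.1, h⟩]
      simpa using hε.le
    · rw [← dist_eq_norm]
      exact (hn s ⟨h, hs.2⟩).le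
  have hdist : Tendsto (fun n => supDist T d x (xs n)) atTop (𝓝 0) := by
    rw [Metric.tendsto_atTop']
    intro ε hε
    obtain ⟨N, hN⟩ := eventually_atTop.1 (hclose (ε / 2) (half_pos hε))
    refine ⟨N, fun n hn => ?_⟩
    have h0 : 0 ≤ supDist T d x (xs n) :=
      Real.sSup_nonneg (by rintro _ ⟨s, _, rfl⟩; exact norm_nonneg _)
    have h1 : supDist T d x (xs n) ≤ ε / 2 :=
      Real.sSup_le (by rintro _ ⟨s, hs, rfl⟩; exact hN n hn.le s hs) (half_pos hε).le
    rw [Real.dist_0_eq_abs, abs_of_nonneg h0]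
    linarith
  have hpt : ∀ t ∈ Icc s₀ T, Tendsto (fun n => xs n t) atTop (𝓝 (x t)) :=
    fun t ht => hlim.tendsto_at ht
  have hxinc : ∀ s t, s₀ ≤ s → s ≤ t → t ≤ T →
      ‖x t - x s‖ ≤ L * (1 + runSup d x t) * (t - s) := by
    intro s t hs hst ht
    have hl := ((hpt t ⟨hs.trans hst, ht⟩).sub (hpt s ⟨hs, hst.trans ht⟩)).norm
    have hε : ∀ ε > 0, ‖x t - x s‖ ≤ L * (1 + (runSup d x t + ε)) * (t - s) := by
      intro ε hε
      refine le_of_tendsto hl ?_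
      filter_upwards [hclose ε hε] with n hn
      refine (hxL n s t hs hst ht).trans ?_
      have h0 : runSup d (xs n) t ≤ runSup d x t + ε := by
        refine supOn_le (add_nonneg (supOn_nonneg 0 x t) hε.le) fun r hr => ?_
        have e1 : ‖x r‖ ≤ runSup d x t := norm_le_supOn hbx hr.1 hr.2 ht
        have e2 := hn r ⟨hr.1, hr.2.trans ht⟩
        have e3 : ‖xs n r‖ ≤ ‖x r‖ + ‖x r - xs n r‖ := norm_le_insert _ _
        linarith
      have := sub_nonneg.2 hst
      gcongr
    have hcl : Tendsto (fun ε => L * (1 + (runSup d x t + ε)) * (t - s)) (𝓝[>] 0)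
        (𝓝 (L * (1 + (runSup d x t + 0)) * (t - s))) :=
      (Continuous.tendsto (by fun_prop) 0).mono_left nhdsWithin_le_nhds
    rw [add_zero] at hcl
    exact ge_of_tendsto hcl (eventually_mem_nhdsWithin.mono hε)
  obtain ⟨g, hg⟩ := exists_xDeriv hT hL hbx hxinc
  obtain ⟨C, hC⟩ := isCompact_Icc.exists_bound_of_continuousOn hy
  have hgz : IntegrableOn (fun s => ⟪g s, z⟫_ℝ) (Icc s₀ T) volume := hg.1.inner_const z
  have hHint : IntegrableOn (fun s => H s x (y s) z) (Icc s₀ T) volume :=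
    integrableOn_ham h1 h2 h3 h6 hs₀.1 hxC z
      ((hy.mono Ioo_subset_Icc_self).aestronglyMeasurable measurableSet_Ioo)
      (fun s hs => hC s (Ioo_subset_Icc_self hs))
  refine ⟨hxC, hx, hy, g, hg, hgz.sub hHint, fun t ht => ?_⟩
  have hii : ∀ w : ℝ → ℝ, IntegrableOn w (Icc s₀ T) volume → IntervalIntegrable w volume s₀ t :=
    fun w hw => (intervalIntegrable_iff_integrableOn_Icc_of_le ht.1).2
      (hw.mono_set (Icc_subset_Icc_right ht.2))
  have hgi : IntervalIntegrable g volume s₀ t :=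
    (intervalIntegrable_iff_integrableOn_Icc_of_le ht.1).2
      (hg.1.mono_set (Icc_subset_Icc_right ht.2))
  have e1 : ∫ s in s₀..t, ⟪g s, z⟫_ℝ = ⟪x t - x s₀, z⟫_ℝ := by
    rw [hg.2.1 t ht, add_sub_cancel_left, real_inner_comm]
    have := (innerSL ℝ z).intervalIntegral_comp_comm hgi
    simpa [real_inner_comm] using this
  change y t = y₀ + ∫ s in s₀..t, (⟪g s, z⟫_ℝ - H s x (y s) z)
  rw [intervalIntegral.integral_sub (hii _ hgz) (hii _ hHint), e1, ← add_sub_assoc]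
  refine tendsto_nhds_unique (hys t ht) ?_
  simp_rw [fun n => hyint n t ht]
  refine (tendsto_const_nhds.add ?_).sub
    (tendsto_integral_ham h1 h2 h3 h6 hs₀.1 hxC hxs hdist hR z hηm hB hη ht)
  exact ((hpt t ht).sub (hpt s₀ ⟨le_rfl, hT⟩)).inner tendsto_const_nhds

end Limits

section Characteristics

variable {T s₀ : ℝ} {d : ℕ} {H : Ham d} {LH CH : ℝ}

/-- Tonelli's delayed approximation of an integral equation. -/
lemma exists_delayed_solution (hT : s₀ ≤ T) {f : ℝ → ℝ → ℝ}
    (hf : ∀ η : ℝ → ℝ, Continuous η → IntegrableOn (fun s => f s (η s)) (Icc s₀ T) volume)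
    (y₀ : ℝ) {δ : ℝ} (hδ : 0 < δ) :
    ∃ y : ℝ → ℝ, Continuous y ∧ (∀ t ≤ s₀, y t = y₀) ∧
      ∀ t ∈ Icc s₀ T, y t = y₀ + ∫ s in s₀..t, f s (y (s - δ)) := by
  let Φ : (ℝ → ℝ) → ℝ → ℝ := fun y t => y₀ + ∫ s in s₀..(projIcc s₀ T hT t), f s (y (s - δ))
  have hcont : ∀ k : ℕ, Continuous (Φ^[k] fun _ => y₀) := by
    intro k
    induction k with
    | zero => exact continuous_const
    | succ k ih =>
      rw [Function.iterate_succ_apply']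
      have h1 := intervalIntegral.continuousOn_primitive_interval (μ := volume)
        (f := fun s => f s ((Φ^[k] fun _ => y₀) (s - δ))) (a := s₀) (b := T)
        (by
          rw [uIcc_of_le hT]
          exact hf (fun s => (Φ^[k] fun _ => y₀) (s - δ)) (ih.comp (by fun_prop)))
      rw [uIcc_of_le hT, continuousOn_iff_continuous_domRestrict] at h1
      exact continuous_const.add (h1.comp continuous_projIcc)
  have hleft : ∀ y, ∀ t ≤ s₀, Φ y t = y₀ := by
    intro y t ht
    simp [Φ, projIcc_of_le_left hT ht]
  have hstab : ∀ k : ℕ, ∀ t ≤ s₀ + k * δ,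
      (Φ^[k + 1] fun _ => y₀) t = (Φ^[k] fun _ => y₀) t := by
    intro k
    induction k with
    | zero =>
      intro t ht
      exact hleft (fun _ => y₀) t (by simpa using ht)
    | succ k ih =>
      intro t ht
      suffices h : Φ (Φ^[k + 1] fun _ => y₀) t = Φ (Φ^[k] fun _ => y₀) t by
        simpa only [Function.iterate_succ_apply'] using h
      change y₀ + _ = y₀ + _
      congr 1
      refine intervalIntegral.integral_congr fun s hs => ?_
      rw [uIcc_of_le (projIcc s₀ T hT t).2.1] at hs
      have h1 : (projIcc s₀ T hT t : ℝ) ≤ s₀ + (k + 1 : ℕ) * δ := by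
        rw [coe_projIcc]
        exact max_le (le_add_of_nonneg_right (by positivity)) ((min_le_right _ _).trans ht)
      have h2 : s - δ ≤ s₀ + k * δ := by
        have := hs.2.trans h1
        push_cast at this
        linarith
      exact congrArg (f s) (ih _ h2)
  obtain ⟨N, hN⟩ := exists_nat_ge ((T - s₀) / δ)
  have hN' : T ≤ s₀ + N * δ := by
    rw [div_le_iff₀ hδ] at hN
    linarith
  have hfix : ∀ t ≤ T, (Φ^[N] fun _ => y₀) t = Φ (Φ^[N] fun _ => y₀) t := by
    intro t ht
    rw [← hstab N t (ht.trans hN'), Function.iterate_succ_apply']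
  refine ⟨Φ^[N] fun _ => y₀, hcont N, fun t ht => ?_, fun t ht => ?_⟩
  · rw [hfix t (ht.trans hT), hleft _ t ht]
  · rw [hfix t ht.2]
    simp only [Φ, projIcc_of_mem hT ht]

lemma supOn_self {F : Type*} [NormedAddCommGroup F] (a : ℝ) (u : ℝ → F) :
    supOn a u a = ‖u a‖ := by
  simp [supOn]

theorem YSet_nonempty (h1 : HamCont T d H) (h2 : HamMeas d H) (h3 : HamLipZ T d H LH)
    (h6 : HamBound T d H CH) {L : ℝ} (hL : 0 ≤ L) (hs₀ : s₀ ∈ Ico 0 T) {x₀ : Path d}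
    (hx₀ : x₀ ∈ Cadlag T d) (y₀ : ℝ) (z : E d) :
    (YSet T d H L s₀ x₀ y₀ z).Nonempty := by
  have hT := hs₀.2.le
  have hLH := h3.1
  have hCH := h6.1
  set x : Path d := fun t => x₀ (min t s₀) with hxdef
  have hx : ∀ t ∈ Icc 0 s₀, x t = x₀ t := fun t ht => by simp [hxdef, ht.2]
  have hxr : ∀ t, s₀ ≤ t → x t = x₀ s₀ := fun t ht => by simp [hxdef, ht]
  have hxC : x ∈ Cadlag T d := Cadlag.of_continuousOn hx₀ hx
    (continuousOn_const.congr fun t ht => hxr t ht.1)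
  set R := runSup d x T
  have hR0 : 0 ≤ R := supOn_nonneg 0 x T
  set K := (CH + LH * ‖z‖) * (1 + R)
  have hK0 : 0 ≤ K := by positivity
  have hint : ∀ η : ℝ → ℝ, Continuous η →
      IntegrableOn (fun s => -H s x (η s) z) (Icc s₀ T) volume := fun η hη => by
    obtain ⟨C, hC⟩ := isCompact_Icc.exists_bound_of_continuousOn (hη.continuousOn (s := Icc s₀ T))
    exact (integrableOn_ham h1 h2 h3 h6 hs₀.1 hxC z hη.aestronglyMeasurable
      (fun s hs => hC s (Ioo_subset_Icc_self hs))).neg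
  set δ : ℕ → ℝ := fun n => 1 / ((n : ℝ) + 1)
  have hδ : ∀ n, 0 < δ n := fun n => by positivity
  have hδ0 : Tendsto δ atTop (𝓝 0) := tendsto_one_div_add_atTop_nhds_zero_nat
  choose ys hyc hyl hyr using fun n => exists_delayed_solution hT
    (f := fun s v => -H s x v z) hint y₀ (hδ n)
  have hyb : ∀ n, BddAbove ((fun s => ‖ys n s‖) '' Icc s₀ T) := fun n =>
    (isCompact_Icc.image (hyc n).norm).bddAbove
  have hdelay : ∀ n, ∀ s ∈ Icc s₀ T, |ys n (s - δ n)| ≤ supOn s₀ (ys n) s := by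
    intro n s hs
    rcases le_total (s - δ n) s₀ with h | h
    · rw [hyl n _ h, ← hyl n s₀ le_rfl]
      exact norm_le_supOn (hyb n) le_rfl hs.1 hs.2
    · exact norm_le_supOn (hyb n) h (by linarith [hδ n]) hs.2
  have hinc : ∀ n s t, s₀ ≤ s → s ≤ t → t ≤ T →
      ‖ys n t - ys n s‖ ≤ K * (1 + supOn s₀ (ys n) t) * (t - s) := by
    intro n
    refine norm_sub_le_of_ae_le hK0 (hyb n)
      (hint (fun s => ys n (s - δ n)) ((hyc n).comp (by fun_prop)))
      (fun t ht => by rw [hyl n s₀ le_rfl]; exact hyr n t ht) ?_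
    filter_upwards [(ham_bound h3 h6 z hR0).filter_mono
      (ae_mono (Measure.restrict_mono_set volume (Ioo_subset_Ioo_left hs₀.1))),
      ae_restrict_mem measurableSet_Ioo] with s hs hsm
    rw [norm_neg, Real.norm_eq_abs]
    refine (hs x hxC (supOn_mono (Cadlag.bddAbove hxC le_rfl) hsm.2.le le_rfl) _).trans ?_
    have := hdelay n s (Ioo_subset_Icc_self hsm)
    gcongr
  set B := 2 ^ ⌈2 * K * (T - s₀)⌉₊ * (1 + |y₀|)
  have hB : ∀ n, ∀ t, t ≤ T → supOn s₀ (ys n) t ≤ B := by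
    intro n t ht
    have h := one_add_supOn_le hT hK0 le_rfl (hyb n) (hinc n)
    rw [supOn_self, hyl n s₀ le_rfl, Real.norm_eq_abs] at h
    have h' := supOn_mono (hyb n) ht le_rfl
    linarith
  have hB0 : 0 ≤ B := (supOn_nonneg _ _ _).trans (hB 0 T le_rfl)
  have hlip : ∀ n s t, s₀ ≤ s → s ≤ t → t ≤ T → ‖ys n t - ys n s‖ ≤ K * (1 + B) * (t - s) := by
    intro n s t hs hst ht
    refine (hinc n s t hs hst ht).trans ?_
    have := hB n t ht
    have := sub_nonneg.2 hst
    gcongr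
  obtain ⟨φ, hφ, y, hy⟩ := exists_subseq_tendstoUniformlyOn hlip
    (fun n t ht => (norm_le_supOn (hyb n) ht.1 le_rfl ht.2).trans (hB n t ht.2))
  have hpt : ∀ t ∈ Icc s₀ T, Tendsto (fun n => ys (φ n) t) atTop (𝓝 (y t)) :=
    fun t ht => hy.tendsto_at ht
  have hδφ := hδ0.comp hφ.tendsto_atTop
  refine ⟨(x, y), mem_YSet_of_tendsto h1 h2 h3 h6 hL hs₀ hx₀ (xs := fun _ => x)
    (ys := fun n => ys (φ n)) (ηs := fun n s => ys (φ n) (s - δ (φ n))) (R := R) (B := B)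
    (fun _ => hxC) (fun _ => hx) hx ?_ (fun _ => le_rfl) ?_
    (hy.continuousOn (Eventually.of_forall fun n => (hyc _).continuousOn).frequently) ?_
    ?_ ?_ hpt ?_⟩
  · intro _ s t hs hst ht
    rw [hxr s hs, hxr t (hs.trans hst), sub_self, norm_zero]
    have : 0 ≤ runSup d x t := supOn_nonneg 0 x t
    have := sub_nonneg.2 hst
    positivity
  · exact Metric.tendstoUniformlyOn_iff.2 fun ε hε => by simp [hε]
  · exact fun n => ((hyc (φ n)).comp (by fun_prop)).aestronglyMeasurable
  · exact fun n s hs => (hdelay _ s (Ioo_subset_Icc_self hs)).trans (hB _ s hs.2.le)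
  · intro s hs
    have hd : Tendsto (fun n => ys (φ n) (s - δ (φ n)) - ys (φ n) s) atTop (𝓝 0) := by
      refine squeeze_zero_norm' (a := fun n => K * (1 + B) * δ (φ n)) ?_
        (by simpa using hδφ.const_mul (K * (1 + B)))
      filter_upwards [hδφ.eventually_lt_const (sub_pos.2 hs.1)] with n hn
      have hn' : s₀ ≤ s - δ (φ n) := by
        have : δ (φ n) < s - s₀ := hn
        linarith
      rw [norm_sub_rev]
      refine (hlip (φ n) _ s hn' (by linarith [hδ (φ n)]) hs.2.le).trans_eq ?_
      ring
    simpa using hd.add (hpt s (Ioo_subset_Icc_self hs))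
  · intro n t ht
    simp only [hyr (φ n) t ht, hxr t ht.1, hxr s₀ le_rfl, sub_self, inner_zero_left, add_zero,
      intervalIntegral.integral_neg, sub_eq_add_neg]

/-- Every sequence of characteristic pairs has a subsequence converging uniformly to a
characteristic pair. -/
theorem YSet_exists_subseq (h1 : HamCont T d H) (h2 : HamMeas d H) (h3 : HamLipZ T d H LH)
    (h6 : HamBound T d H CH) {L : ℝ} (hL : 0 ≤ L) (hs₀ : s₀ ∈ Ico 0 T) {x₀ : Path d}
    (hx₀ : x₀ ∈ Cadlag T d) {y₀ : ℝ} {z : E d} {p : ℕ → Path d × (ℝ → ℝ)}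
    (hp : ∀ n, p n ∈ YSet T d H L s₀ x₀ y₀ z) :
    ∃ q ∈ YSet T d H L s₀ x₀ y₀ z, ∃ φ : ℕ → ℕ, StrictMono φ ∧
      TendstoUniformlyOn (fun n => (p (φ n)).1) q.1 atTop (Icc 0 T) ∧
      TendstoUniformlyOn (fun n => (p (φ n)).2) q.2 atTop (Icc s₀ T) := by
  have hT := hs₀.2.le
  have hLH := h3.1
  have hCH := h6.1
  choose hxC hxs₀ hyc g hg hint hyr using hp
  have hxb : ∀ n, BddAbove ((fun s => ‖(p n).1 s‖) '' Icc 0 T) := fun n =>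
    Cadlag.bddAbove (hxC n) le_rfl
  have hxinc : ∀ n s t, s₀ ≤ s → s ≤ t → t ≤ T →
      ‖(p n).1 t - (p n).1 s‖ ≤ L * (1 + supOn 0 (p n).1 t) * (t - s) := fun n =>
    norm_sub_le_of_ae_le hL (hxb n) (hg n).1 (hg n).2.1 (hg n).2.2
  set R := 2 ^ ⌈2 * L * (T - s₀)⌉₊ * (1 + supOn 0 x₀ s₀)
  have hR : ∀ n t, t ≤ T → supOn 0 (p n).1 t ≤ R := by
    intro n t ht
    have h := one_add_supOn_le hT hL hs₀.1 (hxb n) (hxinc n)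
    rw [supOn_congr (hxs₀ n)] at h
    have h' := supOn_mono (hxb n) ht le_rfl
    linarith
  have hR0 : 0 ≤ R := (supOn_nonneg _ _ _).trans (hR 0 T le_rfl)
  set K := (L * ‖z‖ + (CH + LH * ‖z‖)) * (1 + R)
  have hK0 : 0 ≤ K := by positivity
  have hyb : ∀ n, BddAbove ((fun s => ‖(p n).2 s‖) '' Icc s₀ T) := fun n =>
    (isCompact_Icc.image_of_continuousOn (hyc n).norm).bddAbove
  have hy₀ : ∀ n, (p n).2 s₀ = y₀ := fun n => by simpa using hyr n s₀ ⟨le_rfl, hT⟩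
  have hyinc : ∀ n s t, s₀ ≤ s → s ≤ t → t ≤ T →
      ‖(p n).2 t - (p n).2 s‖ ≤ K * (1 + supOn s₀ (p n).2 t) * (t - s) := by
    intro n
    refine norm_sub_le_of_ae_le hK0 (hyb n) (hint n)
      (fun t ht => by rw [hy₀ n]; exact hyr n t ht) ?_
    filter_upwards [(ham_bound h3 h6 z hR0).filter_mono
      (ae_mono (Measure.restrict_mono_set volume (Ioo_subset_Ioo_left hs₀.1))),
      (hg n).2.2, ae_restrict_mem measurableSet_Ioo] with s hs hgs hsm
    have e1 := hs (p n).1 (hxC n) (hR n s hsm.2.le) ((p n).2 s)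
    have e2 : ‖g n s‖ ≤ L * (1 + R) := by
      refine hgs.trans ?_
      have : runSup d (p n).1 s ≤ R := hR n s hsm.2.le
      gcongr
    have e3 : ‖⟪g n s, z⟫_ℝ‖ ≤ L * (1 + R) * ‖z‖ :=
      (norm_inner_le_norm _ _).trans (by gcongr)
    have e4 : ‖(p n).2 s‖ ≤ supOn s₀ (p n).2 s := norm_le_supOn (hyb n) hsm.1.le le_rfl hsm.2.le
    have e5 := supOn_nonneg s₀ (p n).2 s
    calc ‖⟪g n s, z⟫_ℝ - H s (p n).1 ((p n).2 s) z‖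
        ≤ ‖⟪g n s, z⟫_ℝ‖ + ‖H s (p n).1 ((p n).2 s) z‖ := norm_sub_le _ _
      _ ≤ L * (1 + R) * ‖z‖ * (1 + supOn s₀ (p n).2 s)
          + (CH + LH * ‖z‖) * (1 + R) * (1 + supOn s₀ (p n).2 s) := by
        refine add_le_add (e3.trans ?_) (e1.trans ?_)
        · exact le_mul_of_one_le_right (by positivity) (by linarith)
        · rw [Real.norm_eq_abs] at e4
          gcongr
      _ = K * (1 + supOn s₀ (p n).2 s) := by ring
  set B := 2 ^ ⌈2 * K * (T - s₀)⌉₊ * (1 + |y₀|)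
  have hB : ∀ n, ∀ t, t ≤ T → supOn s₀ (p n).2 t ≤ B := by
    intro n t ht
    have h := one_add_supOn_le hT hK0 le_rfl (hyb n) (hyinc n)
    rw [supOn_self, hy₀ n, Real.norm_eq_abs] at h
    have h' := supOn_mono (hyb n) ht le_rfl
    linarith
  obtain ⟨φ, hφ, v, hv⟩ := exists_subseq_tendstoUniformlyOn (u := fun n => (p n).1)
    (K := L * (1 + R)) (B := R) (a := s₀) (b := T)
    (fun n s t hs hst ht => by
      refine (hxinc n s t hs hst ht).trans ?_
      have := hR n t ht
      have := sub_nonneg.2 hst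
      gcongr)
    (fun n t ht => (norm_le_supOn (hxb n) (hs₀.1.trans ht.1) le_rfl ht.2).trans (hR n t ht.2))
  obtain ⟨ψ, hψ, y, hy⟩ := exists_subseq_tendstoUniformlyOn (u := fun n => (p (φ n)).2)
    (K := K * (1 + B)) (B := B) (a := s₀) (b := T)
    (fun n s t hs hst ht => by
      refine (hyinc (φ n) s t hs hst ht).trans ?_
      have := hB (φ n) t ht
      have := sub_nonneg.2 hst
      gcongr)
    (fun n t ht => (norm_le_supOn (hyb (φ n)) ht.1 le_rfl ht.2).trans (hB (φ n) t ht.2))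
  have hvs₀ : v s₀ = x₀ s₀ := by
    refine tendsto_nhds_unique (hv.tendsto_at ⟨le_rfl, hT⟩) ?_
    simp [hxs₀ _ s₀ ⟨hs₀.1, le_rfl⟩]
  set x : Path d := fun t => if t ≤ s₀ then x₀ t else v t with hxdef
  have hx : ∀ t ∈ Icc 0 s₀, x t = x₀ t := fun t ht => by simp [hxdef, ht.2]
  have hxv : ∀ t ∈ Icc s₀ T, v t = x t := fun t ht => by
    rcases ht.1.eq_or_lt with rfl | h
    · simp [hxdef, hvs₀]
    · simp [hxdef, not_le.2 h]
  have hxlim : TendstoUniformlyOn (fun n => (p (φ (ψ n))).1) x atTop (Icc s₀ T) :=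
    (TendstoUniformlyOn.congr_right (fun u hu => hψ.tendsto_atTop.eventually (hv u hu)) hxv)
  have hxlim' : TendstoUniformlyOn (fun n => (p (φ (ψ n))).1) x atTop (Icc 0 T) := by
    rw [Metric.tendstoUniformlyOn_iff] at hxlim ⊢
    intro ε hε
    filter_upwards [hxlim ε hε] with n hn t ht
    rcases le_total t s₀ with h | h
    · simpa [hx t ⟨ht.1, h⟩, hxs₀ _ t ⟨ht.1, h⟩] using hε
    · exact hn t ⟨h, ht.2⟩
  have hpt : ∀ t ∈ Icc s₀ T, Tendsto (fun n => (p (φ (ψ n))).2 t) atTop (𝓝 (y t)) :=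
    fun t ht => hy.tendsto_at ht
  refine ⟨(x, y), ?_, φ ∘ ψ, hφ.comp hψ, hxlim', hy⟩
  refine mem_YSet_of_tendsto h1 h2 h3 h6 hL hs₀ hx₀ (xs := fun n => (p (φ (ψ n))).1)
    (ys := fun n => (p (φ (ψ n))).2) (ηs := fun n => (p (φ (ψ n))).2) (R := R) (B := B)
    (fun n => hxC _) (fun n => hxs₀ _) hx (fun n => hxinc _) (fun n => hR _ T le_rfl) hxlim
    (hy.continuousOn (Eventually.of_forall fun n => hyc _).frequently)
    (fun n => ((hyc _).mono Ioo_subset_Icc_self).aestronglyMeasurable measurableSet_Ioo)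
    (fun n s hs => (norm_le_supOn (hyb _) hs.1.le le_rfl hs.2.le).trans (hB _ s hs.2.le))
    (fun s hs => hpt s (Ioo_subset_Icc_self hs)) hpt fun n t ht => ?_
  generalize φ (ψ n) = m
  have hii : ∀ w : ℝ → ℝ, IntegrableOn w (Icc s₀ T) volume → IntervalIntegrable w volume s₀ t :=
    fun w hw => (intervalIntegrable_iff_integrableOn_Icc_of_le ht.1).2
      (hw.mono_set (Icc_subset_Icc_right ht.2))
  have hgi : IntervalIntegrable (g m) volume s₀ t :=
    (intervalIntegrable_iff_integrableOn_Icc_of_le ht.1).2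
      ((hg m).1.mono_set (Icc_subset_Icc_right ht.2))
  have hgz : IntegrableOn (fun s => ⟪g m s, z⟫_ℝ) (Icc s₀ T) volume := (hg m).1.inner_const z
  have hHint : IntegrableOn (fun s => H s (p m).1 ((p m).2 s) z) (Icc s₀ T) volume := by
    refine IntegrableOn.congr_fun (hgz.sub (hint m)) (fun s _ => ?_) measurableSet_Icc
    simp only [Pi.sub_apply, sub_sub_cancel]
  have e1 : ∫ s in s₀..t, ⟪g m s, z⟫_ℝ = ⟪(p m).1 t - (p m).1 s₀, z⟫_ℝ := by
    rw [(hg m).2.1 t ht, add_sub_cancel_left, real_inner_comm]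
    have := (innerSL ℝ z).intervalIntegral_comp_comm hgi
    simpa [real_inner_comm] using this
  rw [hyr m t ht, intervalIntegral.integral_sub (hii _ hgz) (hii _ hHint), e1, ← add_sub_assoc]

end Characteristics

/-- Under assumptions (i), (ii), (iii), (vi) on `H`, the sets
`Y^L(s₀, x₀, y₀, z)` are non-empty and compact in `Ω × C([s₀,T], ℝ)` with respect to the
supremum norm. -/
theorem YSet_nonempty_isCompact (T : ℝ) (hT : 0 < T) (d : ℕ) (hd : 1 ≤ d)
    (H : Ham d) (LH CH : ℝ)
    (hH1 : HamCont T d H) (hH2 : HamMeas d H) (hH3 : HamLipZ T d H LH)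
    (hH6 : HamBound T d H CH)
    (L : ℝ) (hL : 0 ≤ L) (s₀ : ℝ) (hs₀ : s₀ ∈ Ico (0 : ℝ) T)
    (x₀ : Path d) (hx₀ : x₀ ∈ Cadlag T d) (y₀ : ℝ) (z : E d) :
    (YSet T d H L s₀ x₀ y₀ z).Nonempty ∧
    IsCompact ((fun p : Path d × (ℝ → ℝ) => (toUnif T d p.1, toUnifR T s₀ p.2)) ''
      YSet T d H L s₀ x₀ y₀ z) := by
  refine ⟨YSet_nonempty hH1 hH2 hH3 hH6 hL hs₀ hx₀ y₀ z, ?_⟩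
  refine IsSeqCompact.isCompact ?_
  intro u hu
  choose p hp hpu using hu
  obtain ⟨q, hq, φ, hφ, h1, h2⟩ := YSet_exists_subseq hH1 hH2 hH3 hH6 hL hs₀ hx₀ hp
  refine ⟨_, ⟨q, hq, rfl⟩, φ, hφ, ?_⟩
  obtain rfl : _ = u := funext hpu
  rw [tendstoUniformlyOn_iff_tendstoUniformly_comp_coe] at h1 h2
  exact (UniformFun.tendsto_iff_tendstoUniformly.2 h1).prodMk_nhds
    (UniformFun.tendsto_iff_tendstoUniformly.2 h2)

end PHJ
end
end

section
/- For every s_0 ∈ [0,T), x_0 ∈ Ω, y_0 ∈ ℝ, and every z, z̃ ∈ ℝ^d with z ≠ z̃, the intersection Y^{L_H}(s_0,x_0,y_0,z) ∩ Y^{L_H}(s_0,x_0,y_0,z̃) is non-empty, where L_H is the constant from condition (iii) of the assumption on H. -/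
open MeasureTheory Set Filter Topology
open scoped InnerProductSpace

noncomputable section

namespace PHJ

/-- Evaluation at `1` of polynomials of bounded degree is a fixed linear combination of
evaluations at points of `[0, t₀]`. -/
lemma exists_eval_one_eq_sum (n : ℕ) {t₀ : ℝ} (ht₀ : 0 < t₀) :
    ∃ (v c : Fin (n + 1) → ℝ), (∀ j, v j ∈ Icc 0 t₀) ∧
      ∀ p : Polynomial ℝ, p.natDegree ≤ n → p.eval 1 = ∑ j, c j * p.eval (v j) := by
  have hn : (0 : ℝ) < n + 1 := by positivity
  refine ⟨fun j => t₀ * (j / (n + 1)), fun j =>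
    (Lagrange.basis Finset.univ (fun j : Fin (n + 1) => t₀ * ((j : ℝ) / (n + 1))) j).eval 1,
    fun j => ⟨by positivity, ?_⟩, fun p hp => ?_⟩
  · have hj : (j : ℝ) ≤ n + 1 := by exact_mod_cast j.2.le
    exact mul_le_of_le_one_right ht₀.le ((div_le_one hn).2 hj)
  · have hinj : Set.InjOn (fun j : Fin (n + 1) => t₀ * ((j : ℝ) / (n + 1)))
        (Finset.univ : Finset (Fin (n + 1))) := by
      intro i _ j _ hij
      have h1 := mul_left_cancel₀ ht₀.ne' hij
      have h2 := (div_left_inj' hn.ne').1 h1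
      exact Fin.ext (by exact_mod_cast h2)
    have hdeg : p.degree < (Finset.univ : Finset (Fin (n + 1))).card := by
      refine lt_of_le_of_lt Polynomial.degree_le_natDegree ?_
      rw [Finset.card_univ, Fintype.card_fin]
      exact_mod_cast Nat.lt_succ_of_le hp
    conv_lhs => rw [Lagrange.eq_interpolate hinj hdeg]
    rw [Lagrange.interpolate_apply, Polynomial.eval_finsetSum]
    refine Finset.sum_congr rfl fun j _ => ?_
    rw [Polynomial.eval_mul, Polynomial.eval_C, mul_comm]

section DegreeFormula

variable {V : Type*} [NormedAddCommGroup V] [NormedSpace ℝ V]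

/-- `t ↦ det (1 + t A)` is a polynomial of degree at most the dimension. -/
lemma exists_polynomial_eval_eq_det [FiniteDimensional ℝ V] (A : V →L[ℝ] V) :
    ∃ p : Polynomial ℝ, p.natDegree ≤ Module.finrank ℝ V ∧
      ∀ t : ℝ, p.eval t = (1 + t • A).det := by
  classical
  let b := Module.finBasis ℝ V
  let M := LinearMap.toMatrix b b (A : V →ₗ[ℝ] V)
  refine ⟨Matrix.det ((Polynomial.X : Polynomial ℝ) • M.map Polynomial.C +
    (1 : Matrix _ _ ℝ).map Polynomial.C), ?_, fun t => ?_⟩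
  · simpa using Polynomial.natDegree_det_X_add_C_le M 1
  · rw [ContinuousLinearMap.det, ← LinearMap.det_toMatrix b, ← Polynomial.coe_evalRingHom,
      RingHom.map_det]
    congr 1
    ext i j
    simp [M, Matrix.one_apply, LinearMap.toMatrix_apply, Finsupp.single_apply, eq_comm]
    split_ifs <;> simp <;> ring

lemma exists_pos_forall_det_pos :
    ∃ η > (0 : ℝ), ∀ A : V →L[ℝ] V, ‖A‖ < η → 0 < (1 + A).det := by
  have h : ∀ᶠ B : V →L[ℝ] V in 𝓝 1, 0 < B.det := by
    refine (ContinuousLinearMap.continuous_det (𝕜 := ℝ) (E := V)).continuousAt.eventually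
      (lt_mem_nhds ?_)
    simp [ContinuousLinearMap.det]
  obtain ⟨η, hη, H⟩ := Metric.eventually_nhds_iff.1 h
  exact ⟨η, hη, fun A hA => H (by simpa [dist_eq_norm] using hA)⟩

/-- A small Lipschitz perturbation of the identity is bijective. -/
lemma bijective_add_smul [CompleteSpace V] {g : V → V} {K : NNReal} (hg : LipschitzWith K g)
    {t : ℝ} (ht : 0 ≤ t) (htK : t * K < 1) : Function.Bijective fun x => x + t • g x := by
  have hlip : LipschitzWith (‖t‖₊ * K) fun x => t • g x := (lipschitzWith_smul t).comp hg
  have hcoe : ((‖t‖₊ * K : NNReal) : ℝ) = t * K := by simp [abs_of_nonneg ht]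
  constructor
  · intro x y hxy
    have h1 : x - y = t • g y - t • g x :=
      sub_eq_sub_iff_add_eq_add.2 (by simpa [add_comm] using hxy)
    have h2 : ‖x - y‖ ≤ t * K * ‖x - y‖ := by
      conv_lhs => rw [h1]
      rw [norm_sub_rev x y]
      rw [← hcoe]
      exact hlip.norm_sub_le y x
    have h3 : ‖x - y‖ = 0 := by nlinarith [norm_nonneg (x - y)]
    exact sub_eq_zero.1 (norm_eq_zero.1 h3)
  · intro y
    have hc : ContractingWith (‖t‖₊ * K) fun x => y - t • g x := by
      refine ⟨by rw [← NNReal.coe_lt_coe, hcoe]; exact_mod_cast htK,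
        LipschitzWith.of_dist_le_mul fun a b => ?_⟩
      rw [dist_sub_left]
      exact hlip.dist_le_mul a b
    have h : y - t • g hc.fixedPoint = hc.fixedPoint := hc.fixedPoint_isFixedPt
    exact ⟨hc.fixedPoint, (sub_eq_iff_eq_add.1 h).symm⟩

variable [FiniteDimensional ℝ V] [MeasurableSpace V] [BorelSpace V] (μ : Measure V)
  [μ.IsAddHaarMeasure]

/-- Lipschitz images of Haar-null sets are null. -/
lemma addHaar_image_eq_zero_of_lipschitzWith {f : V → V} {K : NNReal} (hf : LipschitzWith K f)
    {s : Set V} (hs : μ s = 0) : μ (f '' s) = 0 := by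
  have hH : (Measure.hausdorffMeasure (Module.finrank ℝ V) : Measure V).IsAddHaarMeasure :=
    isAddHaarMeasure_hausdorffMeasure
  refine Measure.absolutelyContinuous_isAddHaarMeasure μ
    (Measure.hausdorffMeasure (Module.finrank ℝ V)) ?_
  have h0 := Measure.absolutelyContinuous_isAddHaarMeasure
    (Measure.hausdorffMeasure (Module.finrank ℝ V)) μ hs
  have := (hf.lipschitzOnWith (s := s)).hausdorffMeasure_image_le
    (d := Module.finrank ℝ V) (by positivity)
  rw [h0, mul_zero] at this
  exact le_antisymm this zero_le

/-- A Lipschitz map that agrees with the identity outside a ball and is close to the identity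
has a derivative whose determinant integrates to the volume of the ball. -/
lemma setIntegral_det_one_add_smul_of_small {g : V → V} {K : NNReal} (hg : LipschitzWith K g)
    {R : ℝ} (hgR : ∀ x, R ≤ ‖x‖ → g x = 0) {t : ℝ} (ht : 0 ≤ t) (htK : t * K < 1)
    (hdet : ∀ A : V →L[ℝ] V, ‖A‖ ≤ K → 0 < (1 + t • A).det) :
    ∫ x in Metric.ball 0 R, (1 + t • fderiv ℝ g x).det ∂μ = μ.real (Metric.ball 0 R) := by
  set f : V → V := fun x => x + t • g x with hf
  set B : Set V := Metric.ball 0 R with hB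
  set s : Set V := B ∩ {x | DifferentiableAt ℝ g x} with hs
  have hbij : Function.Bijective f := bijective_add_smul hg ht htK
  have hfix : ∀ x, x ∉ B → f x = x := fun x hx => by
    simp [hf, hgR x (by simpa [hB] using hx)]
  have himg : f '' B = B := by
    apply Subset.antisymm
    · rintro _ ⟨x, hx, rfl⟩
      by_contra h
      exact h (by rwa [hbij.1 (hfix _ h)])
    · intro y hy
      obtain ⟨x, rfl⟩ := hbij.2 y
      exact ⟨x, by_contra fun h => h (by rwa [hfix x h] at hy), rfl⟩
  have hflip : LipschitzWith (1 + ‖t‖₊ * K) f :=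
    LipschitzWith.id.add ((lipschitzWith_smul t).comp hg)
  have hnull : μ {x | ¬ DifferentiableAt ℝ g x} = 0 := ae_iff.1 hg.ae_differentiableAt
  have hsB : s =ᵐ[μ] B := inter_ae_eq_left_of_ae_eq_univ (eventuallyEq_univ.2 (ae_iff.2 hnull))
  have hsm : MeasurableSet s :=
    Metric.isOpen_ball.measurableSet.inter (measurableSet_of_differentiableAt ℝ g)
  have hfs : μ (f '' s) = μ B := by
    refine le_antisymm (measure_mono (himg ▸ image_mono inter_subset_left)) ?_
    calc μ B ≤ μ (f '' s ∪ f '' {x | ¬ DifferentiableAt ℝ g x}) := by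
          refine measure_mono ?_
          rw [← image_union]
          conv_lhs => rw [← himg]
          refine image_mono fun x hx => ?_
          by_cases h : DifferentiableAt ℝ g x
          · exact Or.inl ⟨hx, h⟩
          · exact Or.inr h
      _ ≤ μ (f '' s) + 0 := by
          rw [← addHaar_image_eq_zero_of_lipschitzWith μ hflip hnull]
          exact measure_union_le _ _
      _ = μ (f '' s) := add_zero _
  have hcv := integral_image_eq_integral_abs_det_fderiv_smul μ hsm
    (f := f) (f' := fun x => 1 + t • fderiv ℝ g x)
    (fun x hx => ((hasFDerivAt_id x).add (hx.2.hasFDerivAt.const_smul t)).hasFDerivWithinAt)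
    hbij.1.injOn (fun _ => (1 : ℝ))
  rw [← setIntegral_congr_set hsB]
  rw [setIntegral_const, measureReal_def, hfs, ← measureReal_def, smul_eq_mul, mul_one] at hcv
  rw [hcv]
  refine integral_congr_ae (ae_of_all _ fun x => ?_)
  have : ‖fderiv ℝ g x‖ ≤ K := norm_fderiv_le_of_lipschitz ℝ hg
  simp [abs_of_pos (hdet _ this)]

/-- A Lipschitz map that agrees with the identity outside a ball has a derivative whose
determinant integrates to the volume of the ball. -/
lemma setIntegral_det_one_add_fderiv {g : V → V} {K : NNReal} (hg : LipschitzWith K g)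
    {R : ℝ} (hgR : ∀ x, R ≤ ‖x‖ → g x = 0) :
    ∫ x in Metric.ball 0 R, (1 + fderiv ℝ g x).det ∂μ = μ.real (Metric.ball 0 R) := by
  obtain ⟨η, hη, hdet⟩ := exists_pos_forall_det_pos (V := V)
  set t₀ : ℝ := min 1 η / (2 * (K + 1)) with ht₀
  have hm : 0 < min 1 η := lt_min one_pos hη
  have ht₀pos : 0 < t₀ := by positivity
  have ht₀K : t₀ * K < min 1 η := by
    rw [ht₀, div_mul_eq_mul_div, div_lt_iff₀ (by positivity)]
    have : (0 : ℝ) ≤ K := K.2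
    nlinarith
  obtain ⟨v, c, hv, hp⟩ := exists_eval_one_eq_sum (Module.finrank ℝ V) ht₀pos
  have hdet_eq : ∀ A : V →L[ℝ] V, (1 + A).det = ∑ j, c j * (1 + v j • A).det := fun A => by
    obtain ⟨p, hdeg, hpe⟩ := exists_polynomial_eval_eq_det A
    simpa [hpe] using hp p hdeg
  have hc : ∑ j, c j = 1 := by
    have := hdet_eq 0
    simpa [ContinuousLinearMap.det] using this.symm
  have hvK : ∀ j, v j * K < min 1 η := fun j =>
    (mul_le_mul_of_nonneg_right (hv j).2 K.2).trans_lt ht₀K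
  have hint : ∀ j, ∫ x in Metric.ball 0 R, (1 + v j • fderiv ℝ g x).det ∂μ =
      μ.real (Metric.ball 0 R) := fun j => by
    refine setIntegral_det_one_add_smul_of_small μ hg hgR (hv j).1
      ((hvK j).trans_le (min_le_left _ _)) fun A hA => hdet _ ?_
    rw [norm_smul, Real.norm_of_nonneg (hv j).1]
    exact (mul_le_mul_of_nonneg_left hA (hv j).1).trans_lt ((hvK j).trans_le (min_le_right _ _))
  have hinteg : ∀ j, IntegrableOn (fun x => (1 + v j • fderiv ℝ g x).det)
      (Metric.ball 0 R) μ := fun j => by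
    have hcont : Continuous fun A : V →L[ℝ] V => (1 + v j • A).det :=
      ContinuousLinearMap.continuous_det.comp (by fun_prop)
    obtain ⟨C, hC⟩ := (isCompact_closedBall (0 : V →L[ℝ] V) K).exists_bound_of_continuousOn
      hcont.continuousOn
    refine Measure.integrableOn_of_bounded (M := C) measure_ball_lt_top.ne
      (hcont.measurable.comp (measurable_fderiv ℝ g)).aestronglyMeasurable
      (ae_of_all _ fun x => hC _ ?_)
    simpa using norm_fderiv_le_of_lipschitz ℝ hg
  rw [integral_congr_ae (ae_of_all _ fun x => hdet_eq (fderiv ℝ g x))]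
  rw [integral_finsetSum _ fun j _ => (hinteg j).const_mul (c j)]
  simp_rw [integral_const_mul, hint]
  rw [← Finset.sum_mul, hc, one_mul]

end DegreeFormula

section RadialProjection

variable {W : Type*} [NormedAddCommGroup W] [NormedSpace ℝ W]

/-- The radial projection onto the closed ball of radius `a`. -/
def radialProj (a : ℝ) (x : W) : W := (a / max a ‖x‖) • x

lemma radialProj_of_norm_le {a : ℝ} (ha : 0 < a) {x : W} (hx : ‖x‖ ≤ a) :
    radialProj a x = x := by
  rw [radialProj, max_eq_left hx, div_self ha.ne', one_smul]

lemma radialProj_of_le_norm {a : ℝ} {x : W} (hx : a ≤ ‖x‖) :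
    radialProj a x = (a / ‖x‖) • x := by
  rw [radialProj, max_eq_right hx]

lemma norm_radialProj_of_le_norm {a : ℝ} (ha : 0 < a) {x : W} (hx : a ≤ ‖x‖) :
    ‖radialProj a x‖ = a := by
  have : ‖x‖ ≠ 0 := (ha.trans_le hx).ne'
  rw [radialProj_of_le_norm hx, norm_smul, Real.norm_of_nonneg (by positivity),
    div_mul_cancel₀ _ this]

lemma lipschitzWith_radialProj {a : ℝ} (ha : 0 < a) :
    LipschitzWith 2 (radialProj a : W → W) := by
  refine LipschitzWith.of_dist_le_mul fun x y => ?_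
  rw [dist_eq_norm, dist_eq_norm]
  set m := max a ‖x‖ with hm
  set m' := max a ‖y‖ with hm'
  have hmpos : 0 < m := lt_max_of_lt_left ha
  have hmpos' : 0 < m' := lt_max_of_lt_left ha
  have h1 : radialProj a x - radialProj a y = (a / m) • (x - y) + (a / m - a / m') • y := by
    rw [radialProj, radialProj, ← hm, ← hm']
    module
  have h2 : a / m ≤ 1 := (div_le_one hmpos).2 (le_max_left _ _)
  have h3 : ‖y‖ / m' ≤ 1 := (div_le_one hmpos').2 (le_max_right _ _)
  have h4 : |m' - m| ≤ ‖x - y‖ := by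
    have := abs_max_sub_max_le_max a ‖y‖ a ‖x‖
    rw [sub_self, abs_zero, max_eq_right (abs_nonneg (‖y‖ - ‖x‖))] at this
    exact this.trans ((abs_norm_sub_norm_le y x).trans_eq (norm_sub_rev y x))
  have h5 : ‖(a / m - a / m') • y‖ ≤ ‖x - y‖ := by
    have : a / m - a / m' = (a / m) * (m' - m) / m' := by
      field_simp
    rw [norm_smul, Real.norm_eq_abs, this, abs_div, abs_mul, abs_of_pos hmpos',
      abs_of_pos (div_pos ha hmpos)]
    calc a / m * |m' - m| / m' * ‖y‖ = (a / m) * (|m' - m| * (‖y‖ / m')) := by ring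
      _ ≤ 1 * (‖x - y‖ * 1) := by gcongr
      _ = ‖x - y‖ := by ring
  rw [h1]
  calc _ ≤ ‖(a / m) • (x - y)‖ + ‖(a / m - a / m') • y‖ := norm_add_le _ _
    _ ≤ 1 * ‖x - y‖ + ‖x - y‖ := by
      refine add_le_add ?_ h5
      rw [norm_smul, Real.norm_of_nonneg (by positivity)]
      gcongr
    _ = ((2 : NNReal) : ℝ) * ‖x - y‖ := by push_cast; ring

end RadialProjection

section Brouwer

variable {W : Type*} [NormedAddCommGroup W] [InnerProductSpace ℝ W] [FiniteDimensional ℝ W]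

/-- If `r` has constant positive norm near `x`, then its derivative at `x` is singular. -/
lemma det_eq_zero_of_norm_eventually_const {r : W → W} {r' : W →L[ℝ] W} {x : W} {R : ℝ}
    (hR : 0 < R) (hr : HasFDerivAt r r' x) (hn : ∀ᶠ y in 𝓝 x, ‖r y‖ = R) : r'.det = 0 := by
  have h1 : HasFDerivAt (fun y => ‖r y‖ ^ 2) (0 : W →L[ℝ] ℝ) x :=
    (hasFDerivAt_const (R ^ 2) x).congr_of_eventuallyEq (hn.mono fun y hy => by simp [hy])
  have h2 := hr.norm_sq.unique h1
  have h3 : ∀ v, ⟪r x, r' v⟫_ℝ = 0 := fun v => by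
    have := DFunLike.congr_fun h2 v
    simpa using this
  have hx : r x ≠ 0 := norm_ne_zero_iff.1 (hn.self_of_nhds.trans_ne hR.ne')
  by_contra hdet
  have hu : IsUnit (LinearMap.det (r' : W →ₗ[ℝ] W)) := isUnit_iff_ne_zero.2 hdet
  obtain ⟨v, hv⟩ := (LinearEquiv.ofIsUnitDet
    (f := (r' : W →ₗ[ℝ] W)) (v := Module.finBasis ℝ W) (v' := Module.finBasis ℝ W)
    (by rwa [LinearMap.det_toMatrix])).surjective (r x)
  have hv' : r' v = r x := hv
  exact hx (inner_self_eq_zero.1 (hv' ▸ h3 v))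

/-- There is no Lipschitz retraction of a closed ball onto its bounding sphere. -/
lemma exists_norm_add_ne {g : W → W} {K : NNReal} (hg : LipschitzWith K g) {R : ℝ}
    (hR : 0 < R) (hgR : ∀ x, R ≤ ‖x‖ → g x = 0) : ∃ x, ‖x‖ < R ∧ ‖x + g x‖ ≠ R := by
  by_contra! h
  borelize W
  let μ : Measure W := Measure.addHaar
  have h1 := setIntegral_det_one_add_fderiv μ hg hgR
  have h2 : ∫ x in Metric.ball 0 R, (1 + fderiv ℝ g x).det ∂μ = 0 := by
    refine setIntegral_eq_zero_of_ae_eq_zero ?_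
    filter_upwards [hg.ae_differentiableAt] with x hx hxR
    refine det_eq_zero_of_norm_eventually_const hR ((hasFDerivAt_id x).add hx.hasFDerivAt) ?_
    filter_upwards [Metric.isOpen_ball.mem_nhds hxR] with y hy
    exact h y (by simpa using hy)
  have h3 : 0 < μ.real (Metric.ball (0 : W) R) :=
    ENNReal.toReal_pos (Metric.measure_ball_pos μ 0 hR).ne' measure_ball_lt_top.ne
  rw [← h1, h2] at h3
  exact lt_irrefl _ h3

/-- **Brouwer's fixed point theorem** for bounded Lipschitz self-maps. -/
theorem exists_fixedPoint_of_lipschitzWith_of_bounded {F : W → W} {K : NNReal}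
    (hF : LipschitzWith K F) {M : ℝ} (hM : ∀ x, ‖F x‖ ≤ M) : ∃ x, F x = x := by
  by_contra! hfix
  have hM0 : 0 ≤ M := (norm_nonneg _).trans (hM 0)
  set R := M + 1 with hRdef
  have hR : 0 < R := by positivity
  let c : W → ℝ := fun x => max 0 (min 1 (R - ‖x‖))
  have hc0 : ∀ x, 0 ≤ c x := fun x => le_max_left _ _
  have hc1 : ∀ x, c x ≤ 1 := fun x => max_le zero_le_one (min_le_left _ _)
  have hcl : ∀ x y, |c x - c y| ≤ ‖x - y‖ := fun x y => by
    have h1 := abs_max_sub_max_le_max 0 (min 1 (R - ‖x‖)) 0 (min 1 (R - ‖y‖))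
    have h2 := abs_min_sub_min_le_max 1 (R - ‖x‖) 1 (R - ‖y‖)
    rw [sub_self, abs_zero, max_eq_right (abs_nonneg (min 1 (R - ‖x‖) - min 1 (R - ‖y‖)))] at h1
    rw [sub_self, abs_zero, sub_sub_sub_cancel_left,
      max_eq_right (abs_nonneg (‖y‖ - ‖x‖))] at h2
    exact h1.trans (h2.trans ((abs_norm_sub_norm_le y x).trans_eq (norm_sub_rev y x)))
  have hcF : LipschitzWith (M.toNNReal + K) fun x => c x • F x := by
    refine LipschitzWith.of_dist_le_mul fun x y => ?_
    rw [dist_eq_norm, dist_eq_norm, NNReal.coe_add, Real.coe_toNNReal _ hM0]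
    have : c x • F x - c y • F y = (c x - c y) • F x + c y • (F x - F y) := by module
    rw [this, add_mul]
    refine (norm_add_le _ _).trans (add_le_add ?_ ?_)
    · rw [norm_smul, Real.norm_eq_abs, mul_comm M]
      exact mul_le_mul (hcl x y) (hM x) (norm_nonneg _) (norm_nonneg _)
    · rw [norm_smul, Real.norm_of_nonneg (hc0 y)]
      exact (mul_le_of_le_one_left (norm_nonneg _) (hc1 y)).trans (hF.norm_sub_le x y)
  let h : W → W := fun x => x - c x • F x
  have hh : LipschitzWith (1 + (M.toNNReal + K)) h := LipschitzWith.id.sub hcF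
  have hh0 : ∀ x, h x ≠ 0 := fun x hx => by
    have h1 : x = c x • F x := sub_eq_zero.1 hx
    have h2 : ‖x‖ ≤ M := by
      rw [h1, norm_smul, Real.norm_of_nonneg (hc0 x)]
      exact (mul_le_of_le_one_left (norm_nonneg _) (hc1 x)).trans (hM x)
    have h3 : c x = 1 := by
      have : (1 : ℝ) ≤ R - ‖x‖ := by linarith
      simp [c, min_eq_left this]
    rw [h3, one_smul] at h1
    exact hfix x h1.symm
  have hhR : ∀ x, ‖x‖ = R → h x = x := fun x hx => by simp [h, c, hx]
  obtain ⟨x₁, -, hx₁⟩ := (isCompact_closedBall (0 : W) R).exists_isMinOn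
    ⟨0, by simp [hR.le]⟩ hh.continuous.norm.continuousOn
  set ε := min R ‖h x₁‖ with hεdef
  have hε : 0 < ε := lt_min hR (norm_pos_iff.2 (hh0 x₁))
  have hεh : ∀ x, ‖x‖ ≤ R → ε ≤ ‖h x‖ := fun x hx =>
    (min_le_right _ _).trans (hx₁ (by simpa using hx))
  let g : W → W := fun x => (R / ε) • radialProj ε (h (radialProj R x)) - radialProj R x
  have hg : LipschitzWith (‖R / ε‖₊ * (2 * ((1 + (M.toNNReal + K)) * 2)) + 2) g :=
    ((lipschitzWith_smul (R / ε)).comp ((lipschitzWith_radialProj hε).comp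
      (hh.comp (lipschitzWith_radialProj hR)))).sub (lipschitzWith_radialProj hR)
  obtain ⟨x, hxR, hx⟩ := exists_norm_add_ne hg hR fun x hx => by
    have h1 := norm_radialProj_of_le_norm hR hx
    simp only [g]
    rw [hhR _ h1, radialProj_of_le_norm (h1.symm ▸ min_le_left _ _ : ε ≤ _), h1, smul_smul,
      div_mul_div_cancel₀ hε.ne', div_self hR.ne', one_smul, sub_self]
  apply hx
  simp only [g]
  rw [radialProj_of_norm_le hR hxR.le, add_sub_cancel, norm_smul,
    norm_radialProj_of_le_norm hε (hεh x hxR.le), Real.norm_of_nonneg (by positivity),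
    div_mul_cancel₀ _ hε.ne']

end Brouwer

section Schauder

variable {W : Type*} [NormedAddCommGroup W]

/-- The hat function of radius `δ` centred at `c`. -/
def hat (δ : ℝ) (c x : W) : ℝ := max 0 (δ - ‖x - c‖)

lemma hat_nonneg (δ : ℝ) (c x : W) : 0 ≤ hat δ c x := le_max_left _ _

lemma abs_hat_sub_hat_le (δ : ℝ) (c x y : W) : |hat δ c x - hat δ c y| ≤ ‖x - y‖ := by
  have h := abs_max_sub_max_le_max 0 (δ - ‖x - c‖) 0 (δ - ‖y - c‖)
  rw [sub_self, abs_zero, max_eq_right (abs_nonneg (δ - ‖x - c‖ - (δ - ‖y - c‖))),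
    sub_sub_sub_cancel_left] at h
  refine h.trans ((abs_norm_sub_norm_le _ _).trans_eq ?_)
  rw [sub_sub_sub_cancel_right, norm_sub_rev]

lemma norm_sub_lt_of_hat_ne_zero {δ : ℝ} {c x : W} (h : hat δ c x ≠ 0) : ‖x - c‖ < δ := by
  by_contra! hle
  exact h (max_eq_left (by linarith))

variable {ι : Type*} [Fintype ι]

/-- Normalized hat functions; they sum to `1` wherever the hat functions sum to at
least `δ / 2`. -/
def hatPartition (δ : ℝ) (c : ι → W) (i : ι) (x : W) : ℝ :=
  hat δ (c i) x / max (δ / 2) (∑ j, hat δ (c j) x)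

lemma hatPartition_nonneg {δ : ℝ} (hδ : 0 < δ) (c : ι → W) (i : ι) (x : W) :
    0 ≤ hatPartition δ c i x :=
  div_nonneg (hat_nonneg _ _ _) (le_max_of_le_left (by positivity))

lemma hatPartition_le_one {δ : ℝ} (hδ : 0 < δ) (c : ι → W) (i : ι) (x : W) :
    hatPartition δ c i x ≤ 1 :=
  (div_le_one (lt_max_of_lt_left (by positivity))).2 <| le_max_of_le_right <|
    Finset.single_le_sum (f := fun j => hat δ (c j) x) (fun j _ => hat_nonneg _ _ _)
      (Finset.mem_univ i)

lemma sum_hatPartition_le_one {δ : ℝ} (hδ : 0 < δ) (c : ι → W) (x : W) :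
    ∑ i, hatPartition δ c i x ≤ 1 := by
  simp_rw [hatPartition]
  rw [← Finset.sum_div, div_le_one (lt_max_of_lt_left (by positivity))]
  exact le_max_right _ _

lemma sum_hatPartition_eq_one {δ : ℝ} (hδ : 0 < δ) (c : ι → W) {x : W} {i : ι}
    (hi : ‖x - c i‖ < δ / 2) : ∑ i, hatPartition δ c i x = 1 := by
  have h1 : δ / 2 ≤ ∑ j, hat δ (c j) x := by
    refine le_trans ?_ (Finset.single_le_sum (f := fun j => hat δ (c j) x)
      (fun j _ => hat_nonneg _ _ _) (Finset.mem_univ i))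
    exact le_max_of_le_right (by linarith)
  simp_rw [hatPartition]
  rw [← Finset.sum_div, max_eq_right h1, div_self]
  exact ((half_pos hδ).trans_le h1).ne'

lemma lipschitzWith_hatPartition {δ : ℝ} (hδ : 0 < δ) (c : ι → W) (i : ι) :
    LipschitzWith ((1 + Fintype.card ι) / (δ / 2)).toNNReal (hatPartition δ c i) := by
  refine LipschitzWith.of_dist_le_mul fun x y => ?_
  rw [dist_eq_norm, dist_eq_norm, Real.norm_eq_abs, Real.coe_toNNReal _ (by positivity)]
  set N : W → ℝ := fun x => max (δ / 2) (∑ j, hat δ (c j) x) with hN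
  have hpos : ∀ x, 0 < N x := fun x => lt_max_of_lt_left (by positivity)
  have h1 : |N y - N x| ≤ Fintype.card ι * ‖x - y‖ := by
    have h := abs_max_sub_max_le_max (δ / 2) (∑ j, hat δ (c j) y) (δ / 2) (∑ j, hat δ (c j) x)
    rw [sub_self, abs_zero, max_eq_right (abs_nonneg (∑ j, hat δ (c j) y - ∑ j, hat δ (c j) x)),
      ← Finset.sum_sub_distrib] at h
    refine h.trans ((Finset.abs_sum_le_sum_abs _ _).trans ?_)
    refine (Finset.sum_le_card_nsmul _ _ ‖x - y‖ fun j _ => ?_).trans_eq (by simp)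
    rw [norm_sub_rev]
    exact abs_hat_sub_hat_le _ _ _ _
  have h2 : hatPartition δ c i x - hatPartition δ c i y =
      (hat δ (c i) x - hat δ (c i) y + hatPartition δ c i y * (N y - N x)) / N x := by
    have e : ∀ z, hatPartition δ c i z = hat δ (c i) z / N z := fun z => rfl
    rw [e, e]
    field_simp [(hpos x).ne', (hpos y).ne']
    ring
  rw [h2, abs_div, abs_of_pos (hpos x), div_mul_eq_mul_div]
  refine div_le_div₀ (by positivity) ?_ (by positivity) (le_max_left _ _)
  rw [add_mul, one_mul]
  refine (abs_add_le _ _).trans (add_le_add (abs_hat_sub_hat_le _ _ _ _) ?_)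
  rw [abs_mul, abs_of_nonneg (hatPartition_nonneg hδ c i y)]
  exact (mul_le_of_le_one_left (abs_nonneg _) (hatPartition_le_one hδ c i y)).trans h1

variable [NormedSpace ℝ W]

lemma exists_norm_map_sub_self_le {K : Set W} (hK : IsCompact K) (hconv : Convex ℝ K)
    (h0 : (0 : W) ∈ K) {Φ : W → W} (hΦ : ContinuousOn Φ K) (hmaps : MapsTo Φ K K)
    {ε : ℝ} (hε : 0 < ε) : ∃ x ∈ K, ‖Φ x - x‖ ≤ ε := by
  obtain ⟨δ, hδ, hu⟩ := Metric.uniformContinuousOn_iff.1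
    (hK.uniformContinuousOn_of_continuous hΦ) ε hε
  obtain ⟨t, htK, htf, hcov⟩ := hK.finite_cover_balls (half_pos hδ)
  have : Fintype t := htf.fintype
  let c : t → W := fun i => i
  let S : EuclideanSpace ℝ t →L[ℝ] W :=
    ∑ i, (EuclideanSpace.proj i : EuclideanSpace ℝ t →L[ℝ] ℝ).smulRight (Φ i)
  have hS : ∀ a, S a = ∑ i, a i • Φ i := fun a => by
    simp [S]
  let G : EuclideanSpace ℝ t → EuclideanSpace ℝ t :=
    fun a => WithLp.toLp 2 fun i => hatPartition δ c i (S a)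
  have hG : LipschitzWith _ G :=
    (PiLp.lipschitzWith_toLp 2 (fun _ : t => ℝ)).comp
      ((LipschitzWith.of_dist_le_mul fun x y => (dist_pi_le_iff (by positivity)).2 fun i =>
        (lipschitzWith_hatPartition hδ c i).dist_le_mul x y).comp S.lipschitz)
  have hGb : ∀ a, ‖G a‖ ≤ √(Fintype.card t) := fun a => by
    rw [EuclideanSpace.norm_eq]
    refine Real.sqrt_le_sqrt ((Finset.sum_le_card_nsmul _ _ 1 fun i _ => ?_).trans_eq (by simp))
    have h1 := hatPartition_nonneg hδ c i (S a)
    rw [Real.norm_of_nonneg h1]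
    exact pow_le_one₀ h1 (hatPartition_le_one hδ c i (S a))
  obtain ⟨a, ha⟩ := exists_fixedPoint_of_lipschitzWith_of_bounded hG hGb
  have hai : ∀ i, a i = hatPartition δ c i (S a) := fun i => by
    conv_lhs => rw [← ha]
  set x := S a with hx
  have hxeq : x = ∑ i, hatPartition δ c i x • Φ i := by
    simp_rw [← hai]
    exact hx.trans (hS a)
  have hxK : x ∈ K := by
    rw [hxeq]
    have hle := sum_hatPartition_le_one hδ c x
    have := hconv.sum_mem (t := (Finset.univ : Finset (Option t)))
      (w := fun o => o.elim (1 - ∑ i, hatPartition δ c i x) fun i => hatPartition δ c i x)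
      (z := fun o => o.elim 0 fun i => Φ i) ?_ ?_ ?_
    · simpa [Fintype.sum_option] using this
    · rintro (_ | i) -
      · simpa using hle
      · exact hatPartition_nonneg hδ c i x
    · simp [Fintype.sum_option]
    · rintro (_ | i) -
      · exact h0
      · exact hmaps (htK i.2)
  refine ⟨x, hxK, ?_⟩
  obtain ⟨i₀, hi₀, hxi₀⟩ := mem_iUnion₂.1 (hcov hxK)
  have hsum : ∑ i, hatPartition δ c i x = 1 :=
    sum_hatPartition_eq_one hδ c (i := ⟨i₀, hi₀⟩) (by simpa [dist_eq_norm] using hxi₀)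
  have hdiff : Φ x - x = ∑ i, hatPartition δ c i x • (Φ x - Φ i) := by
    simp_rw [smul_sub]
    rw [Finset.sum_sub_distrib, ← Finset.sum_smul, hsum, one_smul, ← hxeq]
  rw [hdiff]
  calc _ ≤ ∑ i, hatPartition δ c i x * ε := norm_sum_le_of_le _ fun i _ => by
        rw [norm_smul, Real.norm_of_nonneg (hatPartition_nonneg hδ c i x)]
        by_cases hi : hatPartition δ c i x = 0
        · simp [hi]
        · refine mul_le_mul_of_nonneg_left ?_ (hatPartition_nonneg hδ c i x)
          have h1 := norm_sub_lt_of_hat_ne_zero (div_ne_zero_iff.1 hi).1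
          rw [← dist_eq_norm]
          exact (hu x hxK i (htK i.2) (by rwa [dist_eq_norm])).le
    _ = ε := by rw [← Finset.sum_mul, hsum, one_mul]

/-- **Schauder's fixed point theorem**. -/
theorem exists_fixedPoint_of_isCompact_of_convex {K : Set W} (hK : IsCompact K)
    (hconv : Convex ℝ K) (h0 : (0 : W) ∈ K) {Φ : W → W} (hΦ : ContinuousOn Φ K)
    (hmaps : MapsTo Φ K K) : ∃ x ∈ K, Φ x = x := by
  obtain ⟨x, hxK, hx⟩ := hK.exists_isMinOn ⟨0, h0⟩ (hΦ.sub continuousOn_id).norm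
  refine ⟨x, hxK, sub_eq_zero.1 (norm_eq_zero.1 (le_antisymm (le_of_forall_pos_le_add ?_)
    (norm_nonneg _)))⟩
  intro ε hε
  obtain ⟨y, hyK, hy⟩ := exists_norm_map_sub_self_le hK hconv h0 hΦ hmaps hε
  rw [zero_add]
  exact (hx hyK).trans hy

end Schauder

section FunctionalEquation

variable {F : Type*} [NormedAddCommGroup F] [ProperSpace F] {a b : ℝ}

lemma isCompact_setOf_norm_sub_le (φ : ℝ → ℝ) (hφ : Continuous φ) :
    IsCompact {u : BoundedContinuousFunction (Icc a b) F |
      ∀ s t : Icc a b, s ≤ t → (a = s → u s = 0) ∧ ‖u t - u s‖ ≤ φ t - φ s} := by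
  refine BoundedContinuousFunction.arzela_ascoli₂
    (Metric.closedBall 0 (φ b - φ a)) (isCompact_closedBall _ _) _ ?_ ?_ ?_
  · have hev : ∀ t : Icc a b, Continuous
        fun u : BoundedContinuousFunction (Icc a b) F => u t :=
      fun t => continuous_eval_const t
    simp only [ofPred_forall, ofPred_and]
    refine isClosed_iInter fun s => isClosed_iInter fun t => isClosed_iInter fun _ =>
      IsClosed.inter (isClosed_iInter fun _ => isClosed_eq (hev s) continuous_const)
        (isClosed_le ((hev t).sub (hev s)).norm continuous_const)
  · intro u t hu
    have ha : a ≤ b := t.2.1.trans t.2.2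
    obtain ⟨h0, h1⟩ := hu ⟨a, left_mem_Icc.2 ha⟩ t t.2.1
    have h2 := (hu t ⟨b, right_mem_Icc.2 ha⟩ t.2.2).2
    rw [h0 rfl, sub_zero] at h1
    rw [mem_closedBall_zero_iff]
    linarith [norm_nonneg (u ⟨b, right_mem_Icc.2 ha⟩ - u t)]
  · intro t
    rw [Metric.equicontinuousAt_iff]
    intro ε hε
    have hφt : ContinuousAt (fun s : Icc a b => φ s) t := by fun_prop
    obtain ⟨δ, hδ, h⟩ := Metric.continuousAt_iff.1 hφt ε hε
    refine ⟨δ, hδ, fun s hs u => ?_⟩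
    have h3 := abs_lt.1 (Real.dist_eq _ _ ▸ h hs)
    rcases le_total s t with hst | hst
    · rw [dist_eq_norm]
      exact ((u.2 s t hst).2).trans_lt (by linarith)
    · rw [dist_comm, dist_eq_norm]
      exact ((u.2 t s hst).2).trans_lt (by linarith)

variable [NormedSpace ℝ F]

/-- A functional integral equation `u(t) = ∫ₐᵗ f(u, s) ds` with a Carathéodory right-hand side
of linear growth has a solution. -/
theorem exists_eq_intervalIntegral (hab : a ≤ b)
    (f : BoundedContinuousFunction (Icc a b) F → ℝ → F)
    (hmeas : ∀ u, AEStronglyMeasurable (f u) (volume.restrict (Icc a b)))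
    (hcont : ∀ᵐ t ∂volume.restrict (Icc a b), Continuous fun u => f u t)
    {A C : ℝ} (hA : 0 ≤ A) (hC : 0 ≤ C)
    (hgrowth : ∀ᵐ t ∂volume.restrict (Icc a b), ∀ u m,
      (∀ r : Icc a b, (r : ℝ) ≤ t → ‖u r‖ ≤ m) → ‖f u t‖ ≤ C * (A + m)) :
    ∃ u : BoundedContinuousFunction (Icc a b) F, IntegrableOn (f u) (Icc a b) ∧
      ∀ t : Icc a b, u t = ∫ s in a..t, f u s := by
  have hbd : ∀ u, ∀ᵐ t ∂volume.restrict (Icc a b), ‖f u t‖ ≤ C * (A + ‖u‖) := fun u => by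
    filter_upwards [hgrowth] with t ht
    exact ht u _ fun r _ => u.norm_coe_le_norm r
  have hint : ∀ u, IntegrableOn (f u) (Icc a b) := fun u =>
    ⟨hmeas u, .restrict_of_bounded _ (by simp) (hbd u)⟩
  have hII : ∀ u, ∀ s ∈ Icc a b, ∀ t ∈ Icc a b, IntervalIntegrable (f u) volume s t :=
    fun u s hs t ht => ((hint u).mono_set (uIcc_subset_Icc hs ht)).intervalIntegrable
  let Φ : BoundedContinuousFunction (Icc a b) F → BoundedContinuousFunction (Icc a b) F :=
    fun u => BoundedContinuousFunction.mkOfCompact ⟨fun t => ∫ s in a..t, f u s,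
      continuousOn_iff_continuous_domRestrict.1 (uIcc_of_le hab ▸
        intervalIntegral.continuousOn_primitive_interval
          (by rw [uIcc_of_le hab]; exact hint u))⟩
  have hΦ : ∀ u t, Φ u t = ∫ s in a..t, f u s := fun u t => rfl
  have hΦc : Continuous Φ := by
    refine continuous_iff_continuousAt.2 fun u => ?_
    have hlim : Tendsto (fun v => ∫ s in Icc a b, ‖f v s - f u s‖) (𝓝 u) (𝓝 0) := by
      have := tendsto_integral_filter_of_dominated_convergence
        (μ := volume.restrict (Icc a b)) (l := 𝓝 u) (F := fun v s => ‖f v s - f u s‖)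
        (f := fun _ => (0 : ℝ)) (fun _ => C * (A + (‖u‖ + 1)) + C * (A + ‖u‖))
        (Eventually.of_forall fun v => ((hmeas v).sub (hmeas u)).norm) ?_ (by simp) ?_
      · simpa using this
      · have : ∀ᶠ v in 𝓝 u, ‖v‖ < ‖u‖ + 1 :=
          continuous_norm.continuousAt.eventually_lt continuousAt_const (by simp)
        filter_upwards [this] with v hv
        filter_upwards [hbd v, hbd u] with s h1 h2
        rw [norm_norm]
        refine (norm_sub_le _ _).trans (add_le_add (h1.trans ?_) h2)
        gcongr
      · filter_upwards [hcont] with s hs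
        have := (hs.tendsto u).sub_const (f u s)
        simpa using this.norm
    rw [ContinuousAt, tendsto_iff_dist_tendsto_zero]
    refine squeeze_zero (fun _ => dist_nonneg) (fun v => ?_) hlim
    refine (BoundedContinuousFunction.dist_le
      (integral_nonneg fun _ => norm_nonneg _)).2 fun t => ?_
    have ha : a ∈ Icc a b := left_mem_Icc.2 hab
    rw [hΦ, hΦ, dist_eq_norm, ← intervalIntegral.integral_sub (hII v a ha t t.2)
      (hII u a ha t t.2), intervalIntegral.integral_of_le t.2.1]
    refine (norm_integral_le_integral_norm _).trans (setIntegral_mono_set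
      ((hint v).sub (hint u)).norm (Eventually.of_forall fun _ => norm_nonneg _)
      (Eventually.of_forall fun s hs => ⟨hs.1.le, hs.2.trans t.2.2⟩))
  let φ : ℝ → ℝ := fun t => A * Real.exp (C * (t - a))
  have hφ : ∀ t, HasDerivAt φ (C * (A * Real.exp (C * (t - a)))) t := fun t => by
    have := ((((hasDerivAt_id t).sub_const a).const_mul C).exp).const_mul A
    refine this.congr_deriv ?_
    simp only [id]
    ring
  have hφc : Continuous φ := by fun_prop
  have hφ' : Continuous fun t => C * (A * Real.exp (C * (t - a))) := by fun_prop
  have hφm : Monotone φ := fun s t hst => by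
    have : C * (s - a) ≤ C * (t - a) := by gcongr
    simp only [φ]
    gcongr
  have hφa : φ a = A := by simp [φ]
  refine (exists_fixedPoint_of_isCompact_of_convex
    (isCompact_setOf_norm_sub_le (F := F) (a := a) (b := b) φ hφc) ?_ ?_
      hΦc.continuousOn ?_).elim fun u hu => ⟨u, hint u, fun t => by rw [← hΦ, hu.2]⟩
  · intro u hu v hv c d hc hd hcd s t hst
    obtain ⟨h1, h2⟩ := hu s t hst
    obtain ⟨h3, h4⟩ := hv s t hst
    refine ⟨fun h => by simp [h1 h, h3 h], ?_⟩
    calc ‖(c • u + d • v) t - (c • u + d • v) s‖ = ‖c • (u t - u s) + d • (v t - v s)‖ := by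
          congr 1
          simp only [BoundedContinuousFunction.coe_add, BoundedContinuousFunction.coe_smul,
            Pi.add_apply, smul_sub]
          abel
      _ ≤ c * (φ t - φ s) + d * (φ t - φ s) := by
          refine (norm_add_le _ _).trans ?_
          rw [norm_smul, norm_smul, Real.norm_of_nonneg hc, Real.norm_of_nonneg hd]
          gcongr
      _ = φ t - φ s := by rw [← add_mul, hcd, one_mul]
  · exact fun s t hst => ⟨fun _ => rfl, by simpa using hφm hst⟩
  · intro u hu s t hst
    have ha : a ∈ Icc a b := left_mem_Icc.2 hab
    refine ⟨fun h => by rw [hΦ, ← h, intervalIntegral.integral_same], ?_⟩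
    rw [hΦ, hΦ, intervalIntegral.integral_interval_sub_left (hII u a ha t t.2)
      (hII u a ha s s.2), ← intervalIntegral.integral_eq_sub_of_hasDerivAt
        (fun r _ => hφ r) (hφ'.intervalIntegrable _ _)]
    refine intervalIntegral.norm_integral_le_of_norm_le hst ?_
      (hφ'.intervalIntegrable _ _)
    filter_upwards [(ae_restrict_iff' measurableSet_Icc).1 hgrowth] with r hr hrst
    have hrab : r ∈ Icc a b := ⟨s.2.1.trans hrst.1.le, hrst.2.trans t.2.2⟩
    refine (hr hrab u (φ r - A) fun q hq => ?_).trans_eq (by simp only [φ]; ring)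
    obtain ⟨h0, h1⟩ := hu ⟨a, ha⟩ q q.2.1
    rw [h0 rfl, sub_zero] at h1
    have := hφm hq
    simp only [hφa] at h1
    linarith

end FunctionalEquation

section Paths

variable {T s₀ : ℝ} {d : ℕ}

lemma exists_norm_le_of_mem_cadlag {x : Path d} (hx : x ∈ Cadlag T d) (hs₀ : s₀ ∈ Ico 0 T) :
    ∃ M, 0 ≤ M ∧ ∀ r ∈ Icc 0 s₀, ‖x r‖ ≤ M := by
  suffices h : ∃ M, ∀ r ∈ Icc 0 s₀, ‖x r‖ ≤ M by
    obtain ⟨M, hM⟩ := h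
    exact ⟨M, (norm_nonneg _).trans (hM 0 (left_mem_Icc.2 hs₀.1)), hM⟩
  refine isCompact_Icc.induction_on (p := fun s => ∃ M, ∀ r ∈ s, ‖x r‖ ≤ M) ⟨0, by simp⟩
    (fun s t hst ⟨M, hM⟩ => ⟨M, fun r hr => hM r (hst hr)⟩)
    (fun s t ⟨M, hM⟩ ⟨N, hN⟩ => ⟨max M N, fun r hr => hr.elim
      (fun h => (hM r h).trans (le_max_left _ _)) fun h => (hN r h).trans (le_max_right _ _)⟩)
    fun t ht => ?_
  have hright : ∃ M, ∀ᶠ r in 𝓝[≥] t, ‖x r‖ ≤ M :=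
    ⟨‖x t‖ + 1, ((hx.1 t ⟨ht.1, ht.2.trans_lt hs₀.2⟩).norm.eventually_lt_const
      (lt_add_one _)).mono fun _ h => h.le⟩
  have hleft : ∃ M, ∀ᶠ r in 𝓝[<] t, r ∈ Icc 0 s₀ → ‖x r‖ ≤ M := by
    rcases ht.1.eq_or_lt with rfl | h0
    · exact ⟨0, eventually_nhdsWithin_of_forall fun r hr hr' => absurd hr'.1 (not_le.2 hr)⟩
    · obtain ⟨l, hl⟩ := hx.2 t ⟨h0, ht.2.trans hs₀.2.le⟩
      exact ⟨‖l‖ + 1, (hl.norm.eventually_lt_const (lt_add_one _)).mono fun _ h _ => h.le⟩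
  obtain ⟨M, hM⟩ := hright
  obtain ⟨N, hN⟩ := hleft
  refine ⟨{r | r ∈ Icc 0 s₀ → ‖x r‖ ≤ max M N} ∩ Icc 0 s₀,
    inter_mem (mem_nhdsWithin_of_mem_nhds ?_) self_mem_nhdsWithin, max M N,
    fun r hr => hr.1 hr.2⟩
  rw [← nhdsLT_sup_nhdsGE]
  exact ⟨hN.mono fun r h hr => (h hr).trans (le_max_right _ _),
    hM.mono fun r h _ => h.trans (le_max_left _ _)⟩

lemma stopped_mem_cadlag {x : Path d} (hx : x ∈ Cadlag T d) (s₀ : ℝ) :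
    (fun t => x (min t s₀)) ∈ Cadlag T d := by
  have heq : ∀ {t}, t ≤ s₀ → EqOn (fun t => x (min t s₀)) x (Iio t) := fun ht r hr => by
    simp only [min_eq_left ((mem_Iio.1 hr).le.trans ht)]
  constructor
  · intro t ht
    rcases lt_or_ge t s₀ with h | h
    · refine (hx.1 t ht).congr_of_eventuallyEq ?_ (by simp [h.le])
      filter_upwards [mem_nhdsWithin_of_mem_nhds (Iio_mem_nhds h)] with r hr
      simp [(mem_Iio.1 hr).le]
    · refine continuousWithinAt_const (b := x s₀) |>.congr (fun r hr => ?_) ?_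
      · simp [h.trans hr]
      · simp [h]
  · intro t ht
    rcases le_or_gt t s₀ with h | h
    · obtain ⟨l, hl⟩ := hx.2 t ht
      exact ⟨l, hl.congr' ((heq h).symm.eventuallyEq_of_mem self_mem_nhdsWithin)⟩
    · refine ⟨x s₀, tendsto_const_nhds.congr' ?_⟩
      filter_upwards [mem_nhdsWithin_of_mem_nhds (Ioi_mem_nhds h)] with r hr
      simp [(mem_Ioi.1 hr).le]

lemma add_continuous_mem_cadlag {x y : Path d} (hx : x ∈ Cadlag T d) (hy : Continuous y) :
    (fun t => x t + y t) ∈ Cadlag T d :=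
  ⟨fun t ht => (hx.1 t ht).add hy.continuousWithinAt, fun t ht =>
    let ⟨l, hl⟩ := hx.2 t ht
    ⟨l + y t, hl.add hy.continuousWithinAt⟩⟩

lemma runSup_nonneg (x : Path d) (t : ℝ) : 0 ≤ runSup d x t :=
  Real.sSup_nonneg (by rintro _ ⟨s, -, rfl⟩; exact norm_nonneg _)

/-- Superposition of a Hamiltonian with a measurable function in the `y`-variable is
measurable. -/
lemma HamMeas.aemeasurable_comp {H : Ham d} (hH2 : HamMeas d H) (hH1 : HamCont T d H)
    {x : Path d} (hx : x ∈ Cadlag T d) {y : ℝ → ℝ} (hy : Measurable y) (z : E d) :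
    AEMeasurable (fun t => H t x (y t) z) (volume.restrict (Ioo 0 T)) := by
  let q : ℕ → ℝ → ℝ := fun n t => ⌊(n + 1 : ℝ) * y t⌋ / (n + 1 : ℝ)
  have hq : ∀ n t, |y t - q n t| ≤ 1 / (n + 1 : ℝ) := fun n t => by
    have hn : (0 : ℝ) < n + 1 := by positivity
    have h1 := Int.floor_le ((n + 1 : ℝ) * y t)
    have h2 := Int.lt_floor_add_one ((n + 1 : ℝ) * y t)
    have h3 : y t - q n t = ((n + 1 : ℝ) * y t - ⌊(n + 1 : ℝ) * y t⌋) / (n + 1 : ℝ) := by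
      simp only [q]
      field_simp
    rw [h3, abs_of_nonneg (div_nonneg (by linarith) hn.le)]
    gcongr
    linarith
  refine aemeasurable_of_tendsto_metrizable_ae atTop
    (f := fun n t => H t x (q n t) z) (fun n => Measurable.aemeasurable ?_) ?_
  · have h1 : Measurable fun p : ℝ × ℤ => H p.1 x ((p.2 : ℝ) / (n + 1 : ℝ)) z :=
      measurable_from_prod_countable_left fun k => hH2 x ((k : ℝ) / (n + 1 : ℝ)) z
    exact h1.comp (measurable_id.prodMk (Int.measurable_floor.comp (hy.const_mul _)))
  · filter_upwards [hH1] with t ht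
    rw [Metric.tendsto_atTop]
    intro ε hε
    obtain ⟨δ, hδ, h⟩ := ht x hx (y t) z ε hε
    obtain ⟨N, hN⟩ := exists_nat_one_div_lt hδ
    refine ⟨N, fun n hn => ?_⟩
    rw [dist_comm, Real.dist_eq]
    refine h x hx _ z ?_ ?_ (by simpa using hδ)
    · refine (Real.sSup_le ?_ le_rfl).trans_lt hδ
      rintro _ ⟨s, -, rfl⟩
      simp
    · refine (hq n t).trans_lt (lt_of_le_of_lt ?_ hN)
      gcongr

end Paths

/-- Under assumptions (i), (ii), (iii), (vi) on `H`, for `z ≠ z̃` the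
intersection `Y^{L_H}(s₀,x₀,y₀,z) ∩ Y^{L_H}(s₀,x₀,y₀,z̃)` is non-empty. -/
theorem YSet_inter_nonempty (T : ℝ) (hT : 0 < T) (d : ℕ) (hd : 1 ≤ d)
    (H : Ham d) (LH CH : ℝ)
    (hH1 : HamCont T d H) (hH2 : HamMeas d H) (hH3 : HamLipZ T d H LH)
    (hH6 : HamBound T d H CH)
    (s₀ : ℝ) (hs₀ : s₀ ∈ Ico (0 : ℝ) T)
    (x₀ : Path d) (hx₀ : x₀ ∈ Cadlag T d) (y₀ : ℝ) (z z' : E d) (hzz' : z ≠ z') :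
    (YSet T d H LH s₀ x₀ y₀ z ∩ YSet T d H LH s₀ x₀ y₀ z').Nonempty := by
  have hne : ‖z - z'‖ ≠ 0 := norm_ne_zero_iff.2 (sub_ne_zero.2 hzz')
  have hsT : s₀ ≤ T := hs₀.2.le
  have hle : volume.restrict (Icc s₀ T) ≤ volume.restrict (Ioo 0 T) := by
    rw [Measure.restrict_congr_set Ioo_ae_eq_Icc]
    exact Measure.restrict_mono (Icc_subset_Icc_left hs₀.1) le_rfl
  obtain ⟨M, hM0, hM⟩ := exists_norm_le_of_mem_cadlag hx₀ hs₀
  obtain ⟨hLH, hLip⟩ := hH3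
  obtain ⟨hCH, hBd⟩ := hH6
  let e : E d := ‖z - z'‖⁻¹ • (z - z')
  have he : ‖e‖ = 1 := by rw [norm_smul, norm_inv, norm_norm, inv_mul_cancel₀ hne]
  let ext : BoundedContinuousFunction (Icc s₀ T) (ℝ × ℝ) → ℝ → ℝ × ℝ :=
    fun u t => u (projIcc s₀ T hsT t)
  have hext : ∀ u, Continuous (ext u) := fun u => u.continuous.comp continuous_projIcc
  let X : BoundedContinuousFunction (Icc s₀ T) (ℝ × ℝ) → Path d :=
    fun u t => x₀ (min t s₀) + (ext u t).1 • e
  let Y : BoundedContinuousFunction (Icc s₀ T) (ℝ × ℝ) → ℝ → ℝ := fun u t => y₀ + (ext u t).2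
  have hX : ∀ u, X u ∈ Cadlag T d := fun u =>
    add_continuous_mem_cadlag (stopped_mem_cadlag hx₀ s₀) ((hext u).fst.smul continuous_const)
  have hY : ∀ u, Continuous (Y u) := fun u => continuous_const.add (hext u).snd
  have hXsup : ∀ u m t, t ∈ Icc s₀ T → (∀ r : Icc s₀ T, (r : ℝ) ≤ t → ‖u r‖ ≤ m) →
      runSup d (X u) t ≤ M + m := by
    intro u m t ht hm
    refine csSup_le ((nonempty_Icc.2 (hs₀.1.trans ht.1)).image _) ?_
    rintro _ ⟨r, hr, rfl⟩
    refine (norm_add_le _ _).trans (add_le_add (hM _ ⟨le_min hr.1 hs₀.1, min_le_right _ _⟩) ?_)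
    rw [norm_smul, he, mul_one]
    refine (norm_fst_le _).trans (hm _ ?_)
    rw [coe_projIcc]
    exact max_le ht.1 ((min_le_right _ _).trans hr.2)
  have hXdist : ∀ u v, supDist T d (X u) (X v) ≤ dist u v := by
    intro u v
    refine Real.sSup_le ?_ dist_nonneg
    rintro _ ⟨r, -, rfl⟩
    simp only [X, add_sub_add_left_eq_sub, ← sub_smul, norm_smul, he, mul_one]
    rw [← Prod.fst_sub]
    exact (norm_fst_le _).trans ((dist_eq_norm _ _).symm.trans_le
      (BoundedContinuousFunction.dist_coe_le_dist _))
  have hYdist : ∀ u v t, |Y u t - Y v t| ≤ dist u v := by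
    intro u v t
    simp only [Y, add_sub_add_left_eq_sub]
    rw [← Prod.snd_sub, ← Real.norm_eq_abs]
    exact (norm_snd_le _).trans ((dist_eq_norm _ _).symm.trans_le
      (BoundedContinuousFunction.dist_coe_le_dist _))
  let α : BoundedContinuousFunction (Icc s₀ T) (ℝ × ℝ) → ℝ → ℝ :=
    fun u t => (H t (X u) (Y u t) z - H t (X u) (Y u t) z') / ‖z - z'‖
  let β : BoundedContinuousFunction (Icc s₀ T) (ℝ × ℝ) → ℝ → ℝ :=
    fun u t => α u t * ⟪e, z⟫_ℝ - H t (X u) (Y u t) z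
  have hmeas : ∀ u ζ, AEMeasurable (fun t => H t (X u) (Y u t) ζ)
      (volume.restrict (Icc s₀ T)) := fun u ζ =>
    (hH2.aemeasurable_comp hH1 (hX u) (hY u).measurable ζ).mono_measure hle
  have hcont : ∀ᵐ t ∂volume.restrict (Icc s₀ T), ∀ ζ, Continuous
      fun u => H t (X u) (Y u t) ζ := by
    filter_upwards [ae_mono hle hH1] with t ht ζ
    rw [Metric.continuous_iff]
    intro u ε hε
    obtain ⟨δ, hδ, h⟩ := ht (X u) (hX u) (Y u t) ζ ε hε
    refine ⟨δ, hδ, fun v hv => ?_⟩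
    rw [dist_comm, Real.dist_eq]
    rw [dist_comm] at hv
    exact h _ (hX v) _ ζ ((hXdist u v).trans_lt hv) ((hYdist u v t).trans_lt hv)
      (by simpa using hδ)
  have hα : ∀ᵐ t ∂volume.restrict (Icc s₀ T), ∀ u,
      |α u t| ≤ LH * (1 + runSup d (X u) t) := by
    filter_upwards [ae_mono hle hLip] with t ht u
    rw [abs_div, abs_norm, div_le_iff₀ (by positivity)]
    exact ht _ (hX u) _ _ _
  have hαβ : ∀ u t, ⟪α u t • e, z⟫_ℝ - H t (X u) (Y u t) z = β u t ∧
      ⟪α u t • e, z'⟫_ℝ - H t (X u) (Y u t) z' = β u t := by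
    intro u t
    have h1 : ⟪e, z⟫_ℝ - ⟪e, z'⟫_ℝ = ‖z - z'‖ := by
      rw [← inner_sub_right, real_inner_smul_left, real_inner_self_eq_norm_sq]
      field_simp
    have h2 : α u t * ‖z - z'‖ = H t (X u) (Y u t) z - H t (X u) (Y u t) z' :=
      div_mul_cancel₀ _ hne
    simp only [real_inner_smul_left, β]
    refine ⟨trivial, ?_⟩
    rw [← h1] at h2
    linarith
  have hsol : ∃ u, IntegrableOn (fun t => (α u t, β u t)) (Icc s₀ T) ∧
      ∀ t : Icc s₀ T, u t = ∫ s in s₀..t, (α u s, β u s) := by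
    refine exists_eq_intervalIntegral hsT (fun u t => (α u t, β u t)) (fun u => ?_) ?_
      (A := 1 + M + |y₀|) (C := LH + 2 * LH * ‖z‖ + 2 * CH) (by positivity) (by positivity) ?_
    · have h1 : AEMeasurable (α u) (volume.restrict (Icc s₀ T)) :=
        ((hmeas u z).sub (hmeas u z')).div_const _
      exact (h1.prodMk ((h1.mul_const _).sub (hmeas u z))).aestronglyMeasurable
    · filter_upwards [hcont] with t ht
      have h1 : Continuous fun u => α u t := ((ht z).sub (ht z')).div_const _
      exact h1.prodMk ((h1.mul continuous_const).sub (ht z))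
    · filter_upwards [hα, ae_mono hle hLip, ae_mono hle hBd, ae_restrict_mem measurableSet_Icc]
        with t hα hLip hBd ht u m hm
      have hR := hXsup u m t ht hm
      have hR0 := runSup_nonneg (X u) t
      have hYb : |Y u t| ≤ |y₀| + m := by
        refine (abs_add_le _ _).trans (add_le_add le_rfl ((norm_snd_le _).trans (hm _ ?_)))
        rw [projIcc_of_mem hsT ht]
      have hm0 : 0 ≤ m := (norm_nonneg _).trans (hm ⟨t, ht⟩ le_rfl)
      have h0 : 1 + runSup d (X u) t ≤ 1 + M + |y₀| + m := by linarith [abs_nonneg y₀]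
      have h1 : |α u t| ≤ LH * (1 + M + |y₀| + m) :=
        (hα u).trans (mul_le_mul_of_nonneg_left h0 hLH)
      have h2 : |H t (X u) (Y u t) z| ≤
          LH * (1 + M + |y₀| + m) * ‖z‖ + CH * (2 * (1 + M + |y₀| + m)) := by
        have h3 := hLip (X u) (hX u) (Y u t) z 0
        have h4 := hBd (X u) (hX u) (Y u t)
        rw [sub_zero] at h3
        have h5 : LH * (1 + runSup d (X u) t) * ‖z‖ ≤ LH * (1 + M + |y₀| + m) * ‖z‖ :=
          mul_le_mul_of_nonneg_right (mul_le_mul_of_nonneg_left h0 hLH) (norm_nonneg _)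
        have h6 : CH * (1 + runSup d (X u) t + |Y u t|) ≤ CH * (2 * (1 + M + |y₀| + m)) :=
          mul_le_mul_of_nonneg_left (by linarith) hCH
        linarith [abs_sub_abs_le_abs_sub (H t (X u) (Y u t) z) (H t (X u) (Y u t) 0)]
      have h7 : |β u t| ≤ |α u t| * ‖z‖ + |H t (X u) (Y u t) z| := by
        refine (abs_sub _ _).trans (add_le_add ?_ le_rfl)
        rw [abs_mul]
        gcongr
        simpa [he] using abs_real_inner_le_norm e z
      have h8 : |α u t| * ‖z‖ ≤ LH * (1 + M + |y₀| + m) * ‖z‖ := by gcongr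
      have h9 : 0 ≤ LH * (1 + M + |y₀| + m) := by positivity
      have h10 : 0 ≤ LH * (1 + M + |y₀| + m) * ‖z‖ := by positivity
      have h11 : 0 ≤ CH * (2 * (1 + M + |y₀| + m)) := by positivity
      rw [Prod.norm_def]
      refine max_le ?_ ?_
      · rw [Real.norm_eq_abs]
        linarith
      · rw [Real.norm_eq_abs]
        linarith
  obtain ⟨u, hint, hu⟩ := hsol
  have hY0 : ∀ t ∈ Icc s₀ T, ext u t = ∫ s in s₀..t, (α u s, β u s) := fun t ht => by
    rw [← hu ⟨t, ht⟩]
    exact congrArg u (projIcc_of_mem hsT ht)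
  have hII : ∀ t ∈ Icc s₀ T, IntervalIntegrable (fun s => (α u s, β u s)) volume s₀ t :=
    fun t ht => (hint.mono_set (uIcc_subset_Icc (left_mem_Icc.2 hsT) ht)).intervalIntegrable
  have hfst : ∀ t ∈ Icc s₀ T, (ext u t).1 = ∫ s in s₀..t, α u s := fun t ht => by
    rw [hY0 t ht]
    exact ((ContinuousLinearMap.fst ℝ ℝ ℝ).intervalIntegral_comp_comm (hII t ht)).symm
  have hsnd : ∀ t ∈ Icc s₀ T, (ext u t).2 = ∫ s in s₀..t, β u s := fun t ht => by
    rw [hY0 t ht]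
    exact ((ContinuousLinearMap.snd ℝ ℝ ℝ).intervalIntegral_comp_comm (hII t ht)).symm
  have hs₀X : X u s₀ = x₀ s₀ := by
    simp [X, hfst s₀ (left_mem_Icc.2 hsT)]
  have hXeq : ∀ t ∈ Icc 0 s₀, X u t = x₀ t := fun t ht => by
    have h1 : ext u t = ext u s₀ := by
      simp only [ext, projIcc_of_le_left hsT ht.2, projIcc_left]
    simp [X, h1, hfst s₀ (left_mem_Icc.2 hsT), min_eq_left ht.2]
  have hderiv : XDeriv T d LH s₀ (X u) fun t => α u t • e := by
    refine ⟨hint.fst.smul_const e, fun t ht => ?_, ?_⟩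
    · rw [intervalIntegral.integral_smul_const, ← hfst t ht, hs₀X]
      simp only [X, min_eq_right ht.1]
    · filter_upwards [ae_mono (Measure.restrict_mono Ioo_subset_Icc_self le_rfl) hα] with t ht
      rw [norm_smul, he, mul_one]
      exact ht u
  have hYint : ∀ t ∈ Icc s₀ T, Y u t = y₀ + ∫ s in s₀..t, β u s := fun t ht => by
    rw [← hsnd t ht]
  refine ⟨(X u, Y u), ⟨hX u, hXeq, (hY u).continuousOn, _, hderiv, ?_⟩,
    ⟨hX u, hXeq, (hY u).continuousOn, _, hderiv, ?_⟩⟩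
  · simp only [(hαβ _ _).1]
    exact ⟨hint.snd, hYint⟩
  · simp only [(hαβ _ _).2]
    exact ⟨hint.snd, hYint⟩

end PHJ
end
end
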